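/- arXiv:2010.06802 — 3 statements merged into one kernel-verified Lean document; each statement's English description precedes it below -/
import Mathlib

section
/- Let I ⊆ ℝ be an interval and let Y = {Y(x) : x ∈ I} be a zero-mean Gaussian process with continuous, positive definite covariance kernel k(x,x') = E[Y(x)Y(x')]. Then Y is a Gauss–Markov process if and only if there exist positive functions p and q on I such that p/q is strictly increasing on I and k(x,x') = p(min(x,x'))·q(max(x,x')) for all x, x' ∈ I. -/
open MeasureTheory ProbabilityTheory

namespace GaussMarkov

section CondIndep

lemma generateFrom_image2_inter {Ω : Type*} (m₁ m₂ : MeasurableSpace Ω) :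
    MeasurableSpace.generateFrom
      (Set.image2 (· ∩ ·) {s | MeasurableSet[m₁] s} {s | MeasurableSet[m₂] s}) = m₁ ⊔ m₂ := by
  apply le_antisymm
  · refine MeasurableSpace.generateFrom_le ?_
    rintro _ ⟨A, hA, B, hB, rfl⟩
    exact MeasurableSet.inter (le_sup_left (a := m₁) (b := m₂) A hA)
      (le_sup_right (a := m₁) (b := m₂) B hB)
  · refine sup_le (fun A hA => ?_) fun B hB => ?_
    · exact MeasurableSpace.measurableSet_generateFrom
        ⟨A, hA, Set.univ, @MeasurableSet.univ _ m₂, Set.inter_univ A⟩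
    · exact MeasurableSpace.measurableSet_generateFrom
        ⟨Set.univ, @MeasurableSet.univ _ m₁, B, hB, Set.univ_inter B⟩

lemma isPiSystem_image2_inter {Ω : Type*} (m₁ m₂ : MeasurableSpace Ω) :
    IsPiSystem (Set.image2 (· ∩ ·) {s | MeasurableSet[m₁] s} {s | MeasurableSet[m₂] s}) := by
  rintro _ ⟨A, hA, B, hB, rfl⟩ _ ⟨A', hA', B', hB', rfl⟩ -
  exact ⟨A ∩ A', @MeasurableSet.inter _ m₁ _ _ hA hA', B ∩ B',
    @MeasurableSet.inter _ m₂ _ _ hB hB', Set.inter_inter_inter_comm _ _ _ _⟩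

variable {Ω : Type*} {m' m₁ m₂ n : MeasurableSpace Ω} [mΩ : MeasurableSpace Ω]
  {μ : Measure Ω} [IsProbabilityMeasure μ]

lemma condExp_indicator_of_indep (hm' : m' ≤ mΩ) (hn : n ≤ mΩ) (h : Indep n m' μ)
    {A : Set Ω} (hA : MeasurableSet[n] A) :
    μ⟦A | m'⟧ =ᵐ[μ] fun _ => μ.real A := by
  have := condExp_indep_eq hn hm'
    ((stronglyMeasurable_const (b := (1 : ℝ))).indicator hA) h
  rwa [show (∫ ω, A.indicator (fun _ => (1 : ℝ)) ω ∂μ) = μ.real A from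
    integral_indicator_one (hn A hA)] at this

lemma condExp_indicator_inter_of_indep (hm' : m' ≤ mΩ) (hn : n ≤ mΩ) (h : Indep n m' μ)
    {A C : Set Ω} (hA : MeasurableSet[n] A) (hC : MeasurableSet[m'] C) :
    μ⟦A ∩ C | m'⟧ =ᵐ[μ] fun ω => C.indicator (fun _ => (1 : ℝ)) ω * μ.real A := by
  have e : (A ∩ C).indicator (fun _ => (1 : ℝ))
      = C.indicator (fun _ => (1 : ℝ)) * A.indicator (fun _ => (1 : ℝ)) := by
    rw [Set.inter_comm]
    exact Set.inter_indicator_one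
  have iA : Integrable (A.indicator fun _ => (1 : ℝ)) μ :=
    (integrable_const 1).indicator (hn A hA)
  have iAC : Integrable ((A ∩ C).indicator fun _ => (1 : ℝ)) μ :=
    (integrable_const 1).indicator ((hn A hA).inter (hm' C hC))
  rw [e] at iAC ⊢
  filter_upwards [condExp_mul_of_stronglyMeasurable_left
    ((stronglyMeasurable_const (b := (1 : ℝ))).indicator hC) iAC iA,
    condExp_indicator_of_indep hm' hn h hA] with ω h1 h2
  rw [h1, Pi.mul_apply, h2]

/-- If `n` is independent of `m'` and `m₁, m₂ ≤ n` are independent, then `m₁ ⊔ m'` and `m₂ ⊔ m'`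
are conditionally independent given `m'`. -/
lemma condIndep_sup_of_indep [StandardBorelSpace Ω] (hm' : m' ≤ mΩ) (hn : n ≤ mΩ)
    (h : Indep n m' μ) (h₁ : m₁ ≤ n) (h₂ : m₂ ≤ n) (h₁₂ : Indep m₁ m₂ μ) :
    CondIndep m' (m₁ ⊔ m') (m₂ ⊔ m') hm' μ := by
  refine CondIndepSets.condIndep (sup_le (h₁.trans hn) hm') (sup_le (h₂.trans hn) hm')
    (isPiSystem_image2_inter m₁ m') (isPiSystem_image2_inter m₂ m')
    (generateFrom_image2_inter m₁ m').symm (generateFrom_image2_inter m₂ m').symm ?_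
  rw [condIndepSets_iff]
  · rintro _ _ ⟨A, hA, C, hC, rfl⟩ ⟨B, hB, D, hD, rfl⟩
    simp only
    rw [Set.inter_inter_inter_comm]
    filter_upwards [condExp_indicator_inter_of_indep hm' hn h (h₁ A hA) hC,
      condExp_indicator_inter_of_indep hm' hn h (h₂ B hB) hD,
      condExp_indicator_inter_of_indep hm' hn h
        (@MeasurableSet.inter _ n _ _ (h₁ A hA) (h₂ B hB))
        (@MeasurableSet.inter _ m' _ _ hC hD)] with ω e₁ e₂ e₃
    have eCD : (C ∩ D).indicator (fun _ => (1 : ℝ)) ω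
        = C.indicator (fun _ => (1 : ℝ)) ω * D.indicator (fun _ => (1 : ℝ)) ω :=
      congrFun Set.inter_indicator_one ω
    have eAB : μ.real (A ∩ B) = μ.real A * μ.real B := by
      simp only [Measure.real, (Indep_iff m₁ m₂ μ).1 h₁₂ A B hA hB, ENNReal.toReal_mul]
    rw [Pi.mul_apply, e₁, e₂, e₃, eCD, eAB]
    ring
  · rintro _ ⟨A, hA, C, hC, rfl⟩
    exact (hn A (h₁ A hA)).inter (hm' C hC)
  · rintro _ ⟨A, hA, C, hC, rfl⟩
    exact (hn A (h₂ A hA)).inter (hm' C hC)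

/-- σ-algebras that are conditionally independent given `m'` and each independent of `m'` are
independent. -/
lemma indep_of_condIndep [StandardBorelSpace Ω] {hm' : m' ≤ mΩ} (hm₁ : m₁ ≤ mΩ) (hm₂ : m₂ ≤ mΩ)
    (h : CondIndep m' m₁ m₂ hm' μ) (h₁ : Indep m₁ m' μ) (h₂ : Indep m₂ m' μ) :
    Indep m₁ m₂ μ := by
  rw [Indep_iff]
  intro A B hA hB
  have hAB := (condIndep_iff m' m₁ m₂ hm' hm₁ hm₂ μ).1 h A B hA hB
  have key : μ.real (A ∩ B) = μ.real A * μ.real B := by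
    calc μ.real (A ∩ B) = ∫ ω, (μ⟦A ∩ B | m'⟧) ω ∂μ := by
          rw [integral_condExp hm']
          exact (integral_indicator_one ((hm₁ A hA).inter (hm₂ B hB))).symm
      _ = ∫ _, μ.real A * μ.real B ∂μ := by
          refine integral_congr_ae ?_
          filter_upwards [hAB, condExp_indicator_of_indep hm' hm₁ h₁ hA,
            condExp_indicator_of_indep hm' hm₂ h₂ hB] with ω e e₁ e₂
          rw [e, Pi.mul_apply, e₁, e₂]
      _ = μ.real A * μ.real B := by simp
  rw [← ENNReal.toReal_eq_toReal_iff' (by finiteness) (by finiteness), ENNReal.toReal_mul]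
  exact key

end CondIndep

section Gaussian

variable {Ω : Type*} [mΩ : MeasurableSpace Ω] {μ : Measure Ω} [IsProbabilityMeasure μ]

omit [IsProbabilityMeasure μ] in
/-- A process whose finite linear combinations are all real Gaussian is a Gaussian process. -/
lemma isGaussianProcess_of_linearCombination {T : Type*} {X : T → Ω → ℝ}
    (hX : ∀ t, Measurable (X t))
    (h : ∀ (n : ℕ) (t : Fin n → T) (a : Fin n → ℝ), ∃ m v,
      μ.map (fun ω => ∑ i, a i * X (t i) ω) = gaussianReal m v) :
    IsGaussianProcess X μ where
  hasGaussianLaw J := by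
    refine ⟨isGaussian_of_map_eq_gaussianReal fun L => ?_⟩
    classical
    have e := J.equivFin
    obtain ⟨m, v, hmv⟩ := h J.card (fun i => (e.symm i : T))
      (fun i => L (Pi.single (e.symm i) 1))
    refine ⟨m, v, ?_⟩
    rw [Measure.map_map (by fun_prop) (by fun_prop), ← hmv]
    congr 1
    ext ω
    rw [e.symm.sum_comp (fun j : J => L (Pi.single j 1) * X j ω), Function.comp_apply,
      show L (J.restrict (X · ω)) = L.toLinearMap (J.restrict (X · ω)) from rfl,
      LinearMap.pi_apply_eq_sum_univ L.toLinearMap]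
    refine Finset.sum_congr rfl fun j _ => ?_
    rw [smul_eq_mul, mul_comm]
    refine congrArg₂ (· * ·) (congrArg L (funext fun i => ?_)) rfl
    simp [Pi.single_apply, eq_comm]

/-- The residual of `X s` after subtracting its linear regression on `X t`. -/
noncomputable def residual {T : Type*} (μ : Measure Ω) (X : T → Ω → ℝ) (t s : T) : Ω → ℝ :=
  fun ω => X s ω - cov[X s, X t; μ] / cov[X t, X t; μ] * X t ω

variable {T : Type*} {X : T → Ω → ℝ}

omit [IsProbabilityMeasure μ] in
lemma residual_eq_linear (t s : T) : ∃ J : Finset T, ∃ L : (J → ℝ) →L[ℝ] ℝ,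
    ∀ ω, residual μ X t s ω = L (J.restrict (X · ω)) := by
  classical
  refine ⟨{s, t}, ContinuousLinearMap.proj ⟨s, by simp⟩
    - (cov[X s, X t; μ] / cov[X t, X t; μ]) • ContinuousLinearMap.proj ⟨t, by simp⟩, fun ω => ?_⟩
  simp [residual]

lemma measurable_residual {Ω : Type*} {m : MeasurableSpace Ω} [mΩ : MeasurableSpace Ω]
    {μ : Measure Ω} {X : T → Ω → ℝ} {t s : T} (hs : Measurable[m] (X s))
    (ht : Measurable[m] (X t)) : Measurable[m] (residual μ X t s) :=
  hs.sub (ht.const_mul _)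

lemma measurable_of_residual {Ω : Type*} {m : MeasurableSpace Ω} [mΩ : MeasurableSpace Ω]
    {μ : Measure Ω} {X : T → Ω → ℝ} {t s : T} (hs : Measurable[m] (residual μ X t s))
    (ht : Measurable[m] (X t)) : Measurable[m] (X s) := by
  have := hs.add (ht.const_mul (cov[X s, X t; μ] / cov[X t, X t; μ]))
  convert this using 1
  ext ω
  simp [residual]

lemma covariance_residual_left (hX : IsGaussianProcess X μ) {t : T}
    (ht : cov[X t, X t; μ] ≠ 0) (s : T) : cov[residual μ X t s, X t; μ] = 0 := by
  have h2 (s) := (hX.hasGaussianLaw_eval s).memLp_two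
  unfold residual
  rw [covariance_fun_sub_left (h2 s) ((h2 t).const_mul _) (h2 t), covariance_const_mul_left,
    div_mul_cancel₀ _ ht, sub_self]

lemma covariance_residual (hX : IsGaussianProcess X μ) {t : T}
    (ht : cov[X t, X t; μ] ≠ 0) (s u : T) :
    cov[residual μ X t s, residual μ X t u; μ]
      = cov[X s, X u; μ] - cov[X s, X t; μ] * cov[X t, X u; μ] / cov[X t, X t; μ] := by
  have h2 (s) := (hX.hasGaussianLaw_eval s).memLp_two
  have hr : MemLp (residual μ X t s) 2 μ := (h2 s).sub ((h2 t).const_mul _)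
  change cov[residual μ X t s, fun ω => X u ω - cov[X u, X t; μ] / cov[X t, X t; μ] * X t ω; μ] = _
  rw [covariance_fun_sub_right hr (h2 u) ((h2 t).const_mul _), covariance_const_mul_right,
    covariance_residual_left hX ht, mul_zero, sub_zero]
  unfold residual
  rw [covariance_fun_sub_left (h2 s) ((h2 t).const_mul _) (h2 u), covariance_const_mul_left]
  ring

/-- The residuals on `X t` are jointly independent of `X t`. -/
lemma indep_iSup_residual (hX : IsGaussianProcess X μ) (hXm : ∀ t, Measurable (X t)) {t : T}
    (ht : cov[X t, X t; μ] ≠ 0) :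
    Indep (⨆ s, MeasurableSpace.comap (residual μ X t s) inferInstance)
      (MeasurableSpace.comap (X t) inferInstance) μ := by
  have hrm (s) : Measurable (residual μ X t s) := measurable_residual (hXm s) (hXm t)
  have hG : IsGaussianProcess
      (Sum.elim (fun s : T => residual μ X t s) (fun _ : Unit => X t)) μ := by
    refine hX.of_isGaussianProcess ?_
    rintro (s | _)
    · exact residual_eq_linear t s
    · exact ⟨{t}, ContinuousLinearMap.proj ⟨t, by simp⟩, fun ω => by simp⟩
  have h := hG.indepFun_of_covariance_eq_zero (fun s => (hrm s).aemeasurable)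
    (fun _ => (hXm t).aemeasurable) fun s _ => covariance_residual_left hX ht s
  rw [IndepFun_iff_Indep] at h
  simpa [MeasurableSpace.pi, MeasurableSpace.comap_iSup, MeasurableSpace.comap_comp,
    Function.comp_def] using h

omit [IsProbabilityMeasure μ] in
/-- Uncorrelated families of residuals are independent. -/
lemma indep_iSup_residual_of_covariance_eq_zero (hX : IsGaussianProcess X μ)
    (hXm : ∀ t, Measurable (X t)) (t : T) (A B : Set T)
    (h : ∀ s ∈ A, ∀ u ∈ B, cov[residual μ X t s, residual μ X t u; μ] = 0) :
    Indep (⨆ s : A, MeasurableSpace.comap (residual μ X t s) inferInstance)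
      (⨆ u : B, MeasurableSpace.comap (residual μ X t u) inferInstance) μ := by
  have hrm (s) : Measurable (residual μ X t s) := measurable_residual (hXm s) (hXm t)
  have hG : IsGaussianProcess
      (Sum.elim (fun s : A => residual μ X t s) (fun u : B => residual μ X t u)) μ := by
    refine hX.of_isGaussianProcess ?_
    rintro (s | s) <;> exact residual_eq_linear t s.1
  have h := hG.indepFun_of_covariance_eq_zero (fun s => (hrm s).aemeasurable)
    (fun u => (hrm u).aemeasurable) fun s u => h s s.2 u u.2
  rw [IndepFun_iff_Indep] at h
  simpa [MeasurableSpace.pi, MeasurableSpace.comap_iSup, MeasurableSpace.comap_comp,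
    Function.comp_def] using h

variable {k : T → T → ℝ}

lemma kernel_diag_pos
    (hPD : ∀ (n : ℕ) (x : Fin n → T), Function.Injective x →
      (Matrix.of fun i j => k (x i) (x j)).PosDef) (s : T) : 0 < k s s := by
  simpa using (hPD 1 ![s] (Function.injective_of_subsingleton _)).diag_pos (i := 0)

lemma kernel_symm
    (hPD : ∀ (n : ℕ) (x : Fin n → T), Function.Injective x →
      (Matrix.of fun i j => k (x i) (x j)).PosDef) (s t : T) : k s t = k t s := by
  by_cases h : s = t
  · rw [h]
  · simpa using (hPD 2 ![s, t]
      (by simpa [Function.Injective, Fin.forall_fin_two, eq_comm] using h)).isHermitian.apply 1 0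

lemma kernel_mul_self_lt
    (hPD : ∀ (n : ℕ) (x : Fin n → T), Function.Injective x →
      (Matrix.of fun i j => k (x i) (x j)).PosDef) {s t : T} (h : s ≠ t) :
    k s t * k s t < k s s * k t t := by
  have := (hPD 2 ![s, t]
    (by simpa [Function.Injective, Fin.forall_fin_two, eq_comm] using h)).det_pos
  rw [Matrix.det_fin_two] at this
  simp [kernel_symm hPD t s] at this
  exact this

/-- The covariance of a centered Gaussian process is its kernel. -/
lemma covariance_eq_kernel (hXm : ∀ t, Measurable (X t)) (hX : IsGaussianProcess X μ)
    (hPD : ∀ (n : ℕ) (x : Fin n → T), Function.Injective x →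
      (Matrix.of fun i j => k (x i) (x j)).PosDef)
    (hG : ∀ (n : ℕ) (t : Fin n → T) (a : Fin n → ℝ),
      μ.map (fun ω => ∑ i, a i * X (t i) ω)
        = gaussianReal 0 (∑ i, ∑ j, a i * a j * k (t i) (t j)).toNNReal) (s t : T) :
    cov[X s, X t; μ] = k s t := by
  have h2 (s) := (hX.hasGaussianLaw_eval s).memLp_two
  have hvar (s) : Var[X s; μ] = k s s := by
    have h := hG 1 ![s] ![1]
    simp only [Fin.sum_univ_one, Matrix.cons_val_fin_one, one_mul, mul_one] at h
    rw [← variance_id_map (hXm s).aemeasurable, h, variance_id_gaussianReal,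
      Real.coe_toNNReal _ (kernel_diag_pos hPD s).le]
  by_cases hst : s = t
  · rw [hst, covariance_self (hXm t).aemeasurable, hvar]
  have hnn : 0 ≤ k s s + k s t + (k t s + k t t) := by
    rw [kernel_symm hPD t s]
    nlinarith [kernel_diag_pos hPD s, kernel_diag_pos hPD t, kernel_mul_self_lt hPD hst,
      sq_nonneg (k s s - k t t), abs_nonneg (k s t)]
  have h := hG 2 ![s, t] ![1, 1]
  simp only [Fin.sum_univ_two, Matrix.cons_val_zero, Matrix.cons_val_one, one_mul] at h
  have hv : Var[X s + X t; μ] = k s s + k s t + (k t s + k t t) := by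
    rw [← variance_id_map ((hXm s).add (hXm t)).aemeasurable]
    change Var[id; μ.map fun ω => X s ω + X t ω] = _
    rw [h, variance_id_gaussianReal, Real.coe_toNNReal _ hnn]
  rw [variance_add (h2 s) (h2 t), hvar, hvar, kernel_symm hPD t s] at hv
  linarith

end Gaussian

/-- A continuous kernel with positive diagonal and the Markov factorization is positive. -/
lemma kernel_pos_of_le {I : Set ℝ} (hI : I.OrdConnected) {k : ℝ → ℝ → ℝ}
    (hcont : ContinuousOn (fun r : ℝ × ℝ => k r.1 r.2) (I ×ˢ I))
    (hdiag : ∀ x ∈ I, 0 < k x x)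
    (hM : ∀ s ∈ I, ∀ t ∈ I, ∀ u ∈ I, s ≤ t → t ≤ u → k s u * k t t = k s t * k t u)
    {s u : ℝ} (hs : s ∈ I) (hu : u ∈ I) (hsu : s ≤ u) : 0 < k s u := by
  by_contra! hneg
  have hsub : Set.Icc s u ⊆ I := hI.out hs hu
  have hc1 : ContinuousOn (fun v => k s v) (Set.Icc s u) :=
    hcont.comp (f := fun v => (s, v)) (by fun_prop) fun v hv => ⟨hs, hsub hv⟩
  set S : Set ℝ := Set.Icc s u ∩ (fun v => k s v) ⁻¹' Set.Iic 0 with hS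
  have hSclosed : IsClosed S := hc1.preimage_isClosed_of_isClosed isClosed_Icc isClosed_Iic
  have hSne : S.Nonempty := ⟨u, ⟨hsu, le_rfl⟩, hneg⟩
  have hSbdd : BddBelow S := ⟨s, fun v hv => hv.1.1⟩
  obtain ⟨hv, hkv⟩ : sInf S ∈ S := hSclosed.csInf_mem hSne hSbdd
  set v := sInf S with hvdef
  have hkv : k s v ≤ 0 := hkv
  have hvI := hsub hv
  have hsv : s < v := by
    refine lt_of_le_of_ne hv.1 fun e => ?_
    rw [← e] at hkv
    exact absurd (hdiag s hs) (not_lt.2 hkv)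
  have hpos : ∀ t ∈ Set.Ico s v, 0 < k s t := by
    intro t ht
    by_contra! h
    exact absurd (csInf_le hSbdd (a := t) ⟨⟨ht.1, ht.2.le.trans hv.2⟩, h⟩) (not_le.2 ht.2)
  have hle : ∀ t ∈ Set.Ico s v, k t v ≤ 0 := by
    intro t ht
    have htI : t ∈ I := hsub ⟨ht.1, ht.2.le.trans hv.2⟩
    have h1 := hM s hs t htI v hvI ht.1 ht.2.le
    by_contra! h2
    nlinarith [mul_pos (hpos t ht) h2, hdiag t htI]
  have hc2 : ContinuousOn (fun t => k t v) (Set.Icc s v) :=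
    hcont.comp (f := fun t => (t, v)) (by fun_prop)
      fun t ht => ⟨hsub ⟨ht.1, ht.2.trans hv.2⟩, hvI⟩
  have hlim : k v v ≤ 0 := by
    have hcl : v ∈ closure (Set.Ico s v) := by
      rw [closure_Ico hsv.ne]; exact ⟨hsv.le, le_rfl⟩
    have := (hc2 v ⟨hsv.le, le_rfl⟩).mono Set.Ico_subset_Icc_self
    exact isClosed_Iic.closure_subset
      (this.mem_closure hcl (t := Set.Iic 0) fun t ht => hle t ht)
  exact absurd (hdiag v hvI) (not_lt.2 hlim)

/-- A kernel with the Markov factorization is of the form `p (min x y) * q (max x y)`. -/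
lemma exists_factorization {I : Set ℝ} (hI : I.OrdConnected) {k : ℝ → ℝ → ℝ}
    (hcont : ContinuousOn (fun r : ℝ × ℝ => k r.1 r.2) (I ×ˢ I))
    (hdiag : ∀ x ∈ I, 0 < k x x)
    (hsymm : ∀ x ∈ I, ∀ y ∈ I, k x y = k y x)
    (hdet : ∀ x ∈ I, ∀ y ∈ I, x < y → k x y * k x y < k x x * k y y)
    (hM : ∀ s ∈ I, ∀ t ∈ I, ∀ u ∈ I, s ≤ t → t ≤ u → k s u * k t t = k s t * k t u) :
    ∃ p q : ℝ → ℝ, (∀ x ∈ I, 0 < p x) ∧ (∀ x ∈ I, 0 < q x) ∧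
        StrictMonoOn (fun x => p x / q x) I ∧
        ∀ x ∈ I, ∀ y ∈ I, k x y = p (min x y) * q (max x y) := by
  rcases I.eq_empty_or_nonempty with rfl | ⟨c, hc⟩
  · exact ⟨1, 1, by simp, by simp, by simp [StrictMonoOn], by simp⟩
  have kpos : ∀ x ∈ I, ∀ y ∈ I, x ≤ y → 0 < k x y := fun x hx y hy hxy =>
    kernel_pos_of_le hI hcont hdiag hM hx hy hxy
  set p : ℝ → ℝ := fun x => if x ≤ c then k x c else k x x * k c c / k c x with hp
  set q : ℝ → ℝ := fun x => if x ≤ c then k x x / k x c else k c x / k c c with hq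
  have ppos : ∀ x ∈ I, 0 < p x := by
    intro x hx
    simp only [hp]
    split_ifs with h
    · exact kpos x hx c hc h
    · exact div_pos (mul_pos (hdiag x hx) (hdiag c hc)) (kpos c hc x hx (not_le.1 h).le)
  have qpos : ∀ x ∈ I, 0 < q x := by
    intro x hx
    simp only [hq]
    split_ifs with h
    · exact div_pos (hdiag x hx) (kpos x hx c hc h)
    · exact div_pos (kpos c hc x hx (not_le.1 h).le) (hdiag c hc)
  have fact : ∀ x ∈ I, ∀ y ∈ I, x ≤ y → k x y = p x * q y := by
    intro x hx y hy hxy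
    have hcc := (hdiag c hc).ne'
    simp only [hp, hq]
    split_ifs with h1 h2 h2
    · have := (kpos y hy c hc h2).ne'
      field_simp
      linarith [hM x hx y hy c hc hxy h2]
    · field_simp
      linarith [hM x hx c hc y hy h1 (not_le.1 h2).le]
    · exact absurd (hxy.trans h2) h1
    · have := (kpos c hc x hx (not_le.1 h1).le).ne'
      field_simp
      linarith [hM c hc x hx y hy (not_le.1 h1).le hxy]
  refine ⟨p, q, ppos, qpos, ?_, ?_⟩
  · intro x hx y hy hxy
    simp only
    rw [div_lt_div_iff₀ (qpos x hx) (qpos y hy)]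
    have h := hdet x hx y hy hxy
    rw [fact x hx y hy hxy.le, fact x hx x hx le_rfl, fact y hy y hy le_rfl] at h
    have := mul_pos (ppos x hx) (qpos y hy)
    by_contra! hle
    nlinarith [mul_le_mul_of_nonneg_left hle this.le]
  · intro x hx y hy
    rcases le_total x y with h | h
    · rw [min_eq_left h, max_eq_right h, fact x hx y hy h]
    · rw [min_eq_right h, max_eq_left h, hsymm x hx y hy, fact y hy x hx h]

end GaussMarkov

/-- **Characterization of Gauss–Markov processes (Lemma 1, Ding & Zhang).**
Let `I ⊆ ℝ` be an interval and `Y` a zero-mean Gaussian process on `I` (every finite linear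
combination of its values is a centered real Gaussian) with continuous positive definite
covariance kernel `k`.  Then `Y` is Gauss–Markov (for every `t ∈ I`, the past and the future
are conditionally independent given `Y t`) if and only if there are positive functions
`p, q` on `I` with `p/q` strictly increasing such that
`k x y = p (min x y) * q (max x y)` on `I × I`. -/
theorem gauss_markov_iff_tm_kernel
    {Ω : Type*} [mΩ : MeasurableSpace Ω] [StandardBorelSpace Ω]
    (μ : Measure Ω) [IsProbabilityMeasure μ]
    (I : Set ℝ) (hI : I.OrdConnected)
    (Y : ℝ → Ω → ℝ) (hYmeas : ∀ x, x ∈ I → Measurable (Y x))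
    (k : ℝ → ℝ → ℝ)
    (hkcont : ContinuousOn (fun r : ℝ × ℝ => k r.1 r.2) (I ×ˢ I))
    (hkPD : ∀ (n : ℕ) (x : Fin n → ℝ), (∀ i, x i ∈ I) → Function.Injective x →
      (Matrix.of fun i j => k (x i) (x j)).PosDef)
    (hGauss : ∀ (n : ℕ) (t : Fin n → ℝ), (∀ i, t i ∈ I) → ∀ a : Fin n → ℝ,
      μ.map (fun ω => ∑ i, a i * Y (t i) ω)
        = gaussianReal 0 (∑ i, ∑ j, a i * a j * k (t i) (t j)).toNNReal) :
    (∀ t, ∀ ht : t ∈ I,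
      CondIndep (MeasurableSpace.comap (Y t) inferInstance)
        (⨆ s ∈ {s | s ∈ I ∧ s ≤ t}, MeasurableSpace.comap (Y s) inferInstance)
        (⨆ s ∈ {s | s ∈ I ∧ t ≤ s}, MeasurableSpace.comap (Y s) inferInstance)
        ((hYmeas t ht).comap_le) μ)
    ↔ ∃ p q : ℝ → ℝ, (∀ x ∈ I, 0 < p x) ∧ (∀ x ∈ I, 0 < q x) ∧
        StrictMonoOn (fun x => p x / q x) I ∧
        ∀ x ∈ I, ∀ y ∈ I, k x y = p (min x y) * q (max x y) := by
  have hXm : ∀ s : I, Measurable (Y s) := fun s => hYmeas s s.2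
  have hPD : ∀ (n : ℕ) (x : Fin n → I), Function.Injective x →
      (Matrix.of fun i j => k (x i) (x j)).PosDef := fun n x hx =>
    hkPD n (fun i => x i) (fun i => (x i).2) (Subtype.val_injective.comp hx)
  have hG := fun (n : ℕ) (x : Fin n → I) (a : Fin n → ℝ) =>
    hGauss n (fun i => x i) (fun i => (x i).2) a
  have hX : IsGaussianProcess (fun s : I => Y s) μ :=
    GaussMarkov.isGaussianProcess_of_linearCombination hXm fun n x a => ⟨_, _, hG n x a⟩
  have hcov : ∀ s t : I, cov[Y s, Y t; μ] = k s t :=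
    GaussMarkov.covariance_eq_kernel (k := fun s t : I => k s t) hXm hX hPD hG
  have hdiag : ∀ x ∈ I, 0 < k x x := fun x hx =>
    GaussMarkov.kernel_diag_pos (k := fun s t : I => k s t) hPD ⟨x, hx⟩
  have hsymm : ∀ x ∈ I, ∀ y ∈ I, k x y = k y x := fun x hx y hy =>
    GaussMarkov.kernel_symm (k := fun s t : I => k s t) hPD ⟨x, hx⟩ ⟨y, hy⟩
  have hdet : ∀ x ∈ I, ∀ y ∈ I, x < y → k x y * k x y < k x x * k y y :=
    fun x hx y hy hxy => GaussMarkov.kernel_mul_self_lt (k := fun s t : I => k s t) hPD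
      (s := ⟨x, hx⟩) (t := ⟨y, hy⟩) (fun e => hxy.ne (congrArg Subtype.val e))
  have hvar : ∀ t : I, cov[Y t, Y t; μ] ≠ 0 := fun t => by
    rw [hcov]; exact (hdiag t t.2).ne'
  have hres : ∀ s t u : I, cov[GaussMarkov.residual μ (fun s : I => Y s) t s,
      GaussMarkov.residual μ (fun s : I => Y s) t u; μ] = k s u - k s t * k t u / k t t := by
    intro s t u
    rw [GaussMarkov.covariance_residual hX (hvar t)]
    simp only [hcov]
  have hrm : ∀ t s : I, Measurable (GaussMarkov.residual μ (fun s : I => Y s) t s) :=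
    fun t s => GaussMarkov.measurable_residual (hXm s) (hXm t)
  constructor
  · intro hM
    refine GaussMarkov.exists_factorization hI hkcont hdiag hsymm hdet ?_
    intro s hs t ht u hu hst htu
    have hind := GaussMarkov.indep_iSup_residual hX hXm (hvar ⟨t, ht⟩)
    have hmeas : ∀ {S : Set ℝ} {v : ℝ} (hv : v ∈ I), v ∈ S → t ∈ S →
        MeasurableSpace.comap (GaussMarkov.residual μ (fun s : I => Y s) ⟨t, ht⟩ ⟨v, hv⟩)
          inferInstance ≤ ⨆ s ∈ S, MeasurableSpace.comap (Y s) inferInstance := by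
      intro S v hv hvS htS
      refine Measurable.comap_le (GaussMarkov.measurable_residual ?_ ?_)
      · exact Measurable.of_comap_le
          (le_iSup₂_of_le (f := fun s (_ : s ∈ S) => MeasurableSpace.comap (Y s) inferInstance)
            v hvS le_rfl)
      · exact Measurable.of_comap_le
          (le_iSup₂_of_le (f := fun s (_ : s ∈ S) => MeasurableSpace.comap (Y s) inferInstance)
            t htS le_rfl)
    have hci := condIndep_of_condIndep_of_le_right (condIndep_of_condIndep_of_le_left (hM t ht)
      (hmeas hs ⟨hs, hst⟩ ⟨ht, le_rfl⟩)) (hmeas hu ⟨hu, htu⟩ ⟨ht, le_rfl⟩)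
    have hsu := GaussMarkov.indep_of_condIndep (hrm ⟨t, ht⟩ ⟨s, hs⟩).comap_le
      (hrm ⟨t, ht⟩ ⟨u, hu⟩).comap_le hci
      (indep_of_indep_of_le_left hind (le_iSup (fun s : I => MeasurableSpace.comap
        (GaussMarkov.residual μ (fun s : I => Y s) ⟨t, ht⟩ s) inferInstance) ⟨s, hs⟩))
      (indep_of_indep_of_le_left hind (le_iSup (fun s : I => MeasurableSpace.comap
        (GaussMarkov.residual μ (fun s : I => Y s) ⟨t, ht⟩ s) inferInstance) ⟨u, hu⟩))
    have h2 (s : I) := (hX.hasGaussianLaw_eval s).memLp_two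
    have h0 := IndepFun.covariance_eq_zero ((IndepFun_iff_Indep _ _ _).2 hsu)
      ((h2 ⟨s, hs⟩).sub ((h2 ⟨t, ht⟩).const_mul _)) ((h2 ⟨u, hu⟩).sub ((h2 ⟨t, ht⟩).const_mul _))
    rw [hres] at h0
    have := (hdiag t ht).ne'
    simp only at h0
    field_simp at h0
    linarith
  · rintro ⟨p, q, -, -, -, hk⟩ t ht
    set A : Set I := {s | (s : ℝ) ≤ t}
    set B : Set I := {u | t ≤ (u : ℝ)}
    have hAB := GaussMarkov.indep_iSup_residual_of_covariance_eq_zero hX hXm ⟨t, ht⟩ A B (by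
      intro s hs u hu
      have hs' : (s : ℝ) ≤ t := hs
      have hu' : t ≤ (u : ℝ) := hu
      have htt := (hdiag t ht).ne'
      rw [hres, sub_eq_zero, eq_div_iff htt]
      simp only
      rw [hk s s.2 u u.2, hk s s.2 t ht, hk t ht u u.2, hk t ht t ht, min_eq_left hs',
        max_eq_right hs', min_eq_left hu', max_eq_right hu', min_eq_left (hs'.trans hu'),
        max_eq_right (hs'.trans hu'), min_self, max_self]
      ring)
    have hle : ∀ C : Set I, (⨆ s : C, MeasurableSpace.comap
        (GaussMarkov.residual μ (fun s : I => Y s) ⟨t, ht⟩ s) inferInstance)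
        ≤ ⨆ s : I, MeasurableSpace.comap
          (GaussMarkov.residual μ (fun s : I => Y s) ⟨t, ht⟩ s) inferInstance := fun C =>
      iSup_le fun s => le_iSup (fun s : I => MeasurableSpace.comap
          (GaussMarkov.residual μ (fun s : I => Y s) ⟨t, ht⟩ s) inferInstance) s.1
    have hY : ∀ (C : Set I) (v : ℝ) (hv : v ∈ I), ⟨v, hv⟩ ∈ C →
        MeasurableSpace.comap (Y v) inferInstance ≤ (⨆ s : C, MeasurableSpace.comap
          (GaussMarkov.residual μ (fun s : I => Y s) ⟨t, ht⟩ s) inferInstance)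
          ⊔ MeasurableSpace.comap (Y t) inferInstance := by
      intro C v hv hvC
      refine Measurable.comap_le (GaussMarkov.measurable_of_residual (μ := μ)
        (X := fun s : I => Y s) (t := ⟨t, ht⟩) (s := ⟨v, hv⟩) ?_ ?_)
      · exact Measurable.of_comap_le (le_sup_of_le_left (le_iSup
          (fun s : C => MeasurableSpace.comap
            (GaussMarkov.residual μ (fun s : I => Y s) ⟨t, ht⟩ s) inferInstance) ⟨⟨v, hv⟩, hvC⟩))
      · exact Measurable.of_comap_le le_sup_right
    have hci := GaussMarkov.condIndep_sup_of_indep (hYmeas t ht).comap_le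
      (iSup_le fun s => (hrm ⟨t, ht⟩ s).comap_le)
      (GaussMarkov.indep_iSup_residual hX hXm (hvar ⟨t, ht⟩)) (hle A) (hle B) hAB
    exact condIndep_of_condIndep_of_le_right (condIndep_of_condIndep_of_le_left hci
      (iSup₂_le fun s hs => hY A s hs.1 hs.2)) (iSup₂_le fun s hs => hY B s hs.1 hs.2)
end

section
/- Let k be a tensor Markov kernel on (0,1)^d satisfying Assumption SL, n ≥ 3, and let the design points form a truncated sparse grid X_n^TSG = X_τ^SG ∪ A, with every design point written with its canonical index: c_{l,i} with i ∈ ρ(l), where |l| ≤ τ+d−1 for points of X_τ^SG and |l| = τ+d for points of A. For each index (l,i) define the open hyperrectangle R_{l,i} := ∏_{j=1}^d (c_{l_j, i_j−1}, c_{l_j, i_j+1}). Suppose the pair of design points c_{l',i'}, c_{l'',i''} satisfies one of: (a) both belong to A and c_{l',i'} ≠ c_{l'',i''}; (b) c_{l',i'} ∈ X_τ^SG, c_{l'',i''} ∈ A, and c_{l'',i''} ∉ R_{l',i'}; (c) both belong to X_τ^SG, |i'_j·2^{max(l'_j,l''_j)−l'_j} − i''_j·2^{max(l'_j,l''_j)−l''_j}|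 ≥ 2 for some j ∈ {1,…,d}, and no point of A lies in R_{l',i'} ∩ R_{l'',i''}. Then the entry of K^{-1} indexed by the pair (c_{l',i'}, c_{l'',i''}) is zero (and by symmetry so is the entry indexed by (c_{l'',i''}, c_{l',i'})). -/
open Matrix

noncomputable section

/-- The dyadic point `c_{l,i} = i · 2^{-l}`. -/
def cpt (l i : ℕ) : ℝ := (i : ℝ) / 2 ^ l

/-- The multidimensional dyadic point `c_{l,i}`. -/
def cpoint {d : ℕ} (l i : Fin d → ℕ) : Fin d → ℝ := fun j => cpt (l j) (i j)

/-- The set `ρ(l)` of odd multi-indices associated with the level multi-index `l`. -/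
def rho {d : ℕ} (l : Fin d → ℕ) : Set (Fin d → ℕ) :=
  {i | ∀ j, Odd (i j) ∧ 1 ≤ i j ∧ i j ≤ 2 ^ (l j) - 1}

/-- The classical sparse grid of level `τ` in dimension `d`. -/
def SGset (d τ : ℕ) : Set (Fin d → ℝ) :=
  {x | ∃ l : Fin d → ℕ, (∀ j, 1 ≤ l j) ∧ (∑ j, l j) ≤ τ + d - 1 ∧
    ∀ j, ∃ i : ℕ, 1 ≤ i ∧ i ≤ 2 ^ (l j) - 1 ∧ x j = cpt (l j) i}

/-- A tensor Markov kernel on `(0,1)^d` satisfying Assumption SL: factors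
`p_j, q_j` are continuous on `[0,1]`, positive on `(0,1)`, satisfy the strict
"determinant" positivity (the precise form of `p_j/q_j` strictly increasing with
`p_j, q_j > 0`), are continuously differentiable on `(0,1)`, and both solve the
Sturm–Liouville equation `(u_j f')' + v_j f = 0` on `(0,1)`. -/
structure TMKernelSL (d : ℕ) where
  p : Fin d → ℝ → ℝ
  q : Fin d → ℝ → ℝ
  cont_p : ∀ j, ContinuousOn (p j) (Set.Icc 0 1)
  cont_q : ∀ j, ContinuousOn (q j) (Set.Icc 0 1)
  pos_p : ∀ j, ∀ x ∈ Set.Ioo (0:ℝ) 1, 0 < p j x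
  pos_q : ∀ j, ∀ x ∈ Set.Ioo (0:ℝ) 1, 0 < q j x
  det_pos : ∀ j, ∀ y ∈ Set.Icc (0:ℝ) 1, ∀ x ∈ Set.Icc (0:ℝ) 1, y < x →
    0 < p j x * q j y - p j y * q j x
  u : Fin d → ℝ → ℝ
  v : Fin d → ℝ → ℝ
  contDiff_p : ∀ j, ContDiffOn ℝ 1 (p j) (Set.Ioo 0 1)
  contDiff_q : ∀ j, ContDiffOn ℝ 1 (q j) (Set.Ioo 0 1)
  contDiff_u : ∀ j, ContDiffOn ℝ 1 (u j) (Set.Ioo 0 1)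
  cont_v : ∀ j, ContinuousOn (v j) (Set.Ioo 0 1)
  sl_p : ∀ j, ∀ x ∈ Set.Ioo (0:ℝ) 1,
    deriv (fun t => u j t * deriv (p j) t) x + v j x * p j x = 0
  sl_q : ∀ j, ∀ x ∈ Set.Ioo (0:ℝ) 1,
    deriv (fun t => u j t * deriv (q j) t) x + v j x * q j x = 0

/-- The tensor Markov kernel `k(x,x') = ∏_j p_j(min) q_j(max)`. -/
def TMKernelSL.k {d : ℕ} (κ : TMKernelSL d) (x x' : Fin d → ℝ) : ℝ :=
  ∏ j, κ.p j (min (x j) (x' j)) * κ.q j (max (x j) (x' j))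

/-- The `j`-th one-dimensional factor kernel of a TM kernel. -/
def TMKernelSL.k1 {d : ℕ} (κ : TMKernelSL d) (j : Fin d) (a b : ℝ) : ℝ :=
  κ.p j (min a b) * κ.q j (max a b)

/-- Kernel matrix of the design `x_1,…,x_n`. -/
def kerMat {d n : ℕ} (κ : TMKernelSL d) (x : Fin n → Fin d → ℝ) :
    Matrix (Fin n) (Fin n) ℝ :=
  Matrix.of fun a b => κ.k (x a) (x b)

/-- Kernel vector `k(z) = (k(z,x_1),…,k(z,x_n))`. -/
def kerVec {d n : ℕ} (κ : TMKernelSL d) (x : Fin n → Fin d → ℝ) (z : Fin d → ℝ) :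
    Fin n → ℝ :=
  fun a => κ.k z (x a)

/-- `x_1,…,x_n` is a truncated sparse grid design: the points are distinct, and for the level
`τ` with `|X_τ^SG| ≤ n < |X_{τ+1}^SG|`, the design contains all of `X_τ^SG` and is contained
in `X_{τ+1}^SG`. -/
def IsTSGDesign {d n : ℕ} (x : Fin n → Fin d → ℝ) : Prop :=
  Function.Injective x ∧
  ∃ τ : ℕ, 1 ≤ τ ∧ (SGset d τ).ncard ≤ n ∧ n < (SGset d (τ + 1)).ncard ∧
    SGset d τ ⊆ Set.range x ∧ Set.range x ⊆ SGset d (τ + 1)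

/-- One-dimensional quantity `η_{l,i}` (the squared RKHS norm of the hat function). -/
def eta1 (p q : ℝ → ℝ) (l i : ℕ) : ℝ :=
  (p (cpt l (i + 1)) * q (cpt l (i - 1)) - p (cpt l (i - 1)) * q (cpt l (i + 1))) /
    ((p (cpt l i) * q (cpt l (i - 1)) - p (cpt l (i - 1)) * q (cpt l i)) *
      (p (cpt l (i + 1)) * q (cpt l i) - p (cpt l i) * q (cpt l (i + 1))))

/-- Multidimensional `η_{l,i} = ∏_j η^{(j)}_{l_j,i_j}`. -/
def etaP {d : ℕ} (p q : Fin d → ℝ → ℝ) (l i : Fin d → ℕ) : ℝ :=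
  ∏ j, eta1 (p j) (q j) (l j) (i j)

/-- One-dimensional hat function `φ_{l,i}` associated with `p, q`. -/
def phi1 (p q : ℝ → ℝ) (l i : ℕ) (x : ℝ) : ℝ :=
  if cpt l (i - 1) < x ∧ x ≤ cpt l i then
    (p x * q (cpt l (i - 1)) - p (cpt l (i - 1)) * q x) /
      (p (cpt l i) * q (cpt l (i - 1)) - p (cpt l (i - 1)) * q (cpt l i))
  else if cpt l i < x ∧ x < cpt l (i + 1) then
    (p (cpt l (i + 1)) * q x - p x * q (cpt l (i + 1))) /
      (p (cpt l (i + 1)) * q (cpt l i) - p (cpt l i) * q (cpt l (i + 1)))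
  else 0

/-- Multidimensional hat function `φ_{l,i}(x) = ∏_j φ^{(j)}_{l_j,i_j}(x_j)`. -/
def phiD {d : ℕ} (p q : Fin d → ℝ → ℝ) (l i : Fin d → ℕ) (x : Fin d → ℝ) : ℝ :=
  ∏ j, phi1 (p j) (q j) (l j) (i j) (x j)

/-- The open hyperrectangle `R_{l,i} = ∏_j (c_{l_j,i_j−1}, c_{l_j,i_j+1})`. -/
def hyperRect {d : ℕ} (l i : Fin d → ℕ) : Set (Fin d → ℝ) :=
  {z | ∀ j, cpt (l j) (i j - 1) < z j ∧ z j < cpt (l j) (i j + 1)}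

/-- Number of nonzero entries of a real matrix. -/
def nnzM {α β : Type*} [Fintype α] [Fintype β] (M : Matrix α β ℝ) : ℕ :=
  Set.ncard {ab : α × β | M ab.1 ab.2 ≠ 0}

end

/-- The dyadic level of `t`: the least `l` such that `t` is a multiple of `2^{-l}`. -/
noncomputable def dyadicLevel (t : ℝ) : ℕ := sInf {l | ∃ i : ℕ, t = cpt l i}

/-- Dyadic points of `(0,1)`. -/
def IsDyadic (t : ℝ) : Prop := t ∈ Set.Ioo (0 : ℝ) 1 ∧ ∃ l i : ℕ, t = cpt l i

/-- The mesh width `2^{-l}` at the level `l` of `t`. -/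
noncomputable def mesh (t : ℝ) : ℝ := 1 / 2 ^ dyadicLevel t

/-- `s ∈ (0,1)` is `t` or one of its two neighbours on the uniform grid whose level is the
level of `t`. -/
def IsNbr (s t : ℝ) : Prop :=
  s ∈ Set.Ioo (0 : ℝ) 1 ∧ (s = t - mesh t ∨ s = t ∨ s = t + mesh t)

lemma mesh_pos (t : ℝ) : 0 < mesh t := by unfold mesh; positivity

lemma dyadicLevel_cpt_le (l i : ℕ) : dyadicLevel (cpt l i) ≤ l := Nat.sInf_le ⟨i, rfl⟩

lemma dyadicLevel_cpt_of_odd {l i : ℕ} (hi : Odd i) : dyadicLevel (cpt l i) = l := by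
  refine le_antisymm (dyadicLevel_cpt_le l i) ?_
  by_contra! hlt
  obtain ⟨m, hm⟩ : ∃ m : ℕ, cpt l i = cpt (dyadicLevel (cpt l i)) m :=
    Nat.sInf_mem (s := {l' | ∃ m : ℕ, cpt l i = cpt l' m}) ⟨l, i, rfl⟩
  generalize dyadicLevel (cpt l i) = k at hm hlt
  obtain ⟨e, rfl⟩ := Nat.exists_eq_add_of_lt hlt
  have h : i = m * 2 ^ (e + 1) := by
    unfold cpt at hm
    rw [div_eq_div_iff (by positivity) (by positivity)] at hm
    have h2 : (2 : ℝ) ^ k ≠ 0 := by positivity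
    have : (i : ℝ) = m * 2 ^ (e + 1) := by
      apply mul_right_cancel₀ h2
      rw [hm]; ring
    exact_mod_cast this
  rw [h, pow_succ, ← mul_assoc] at hi
  exact (Nat.not_odd_iff_even.2 (even_two.mul_left _)) hi

lemma IsDyadic.exists_index {t : ℝ} (ht : IsDyadic t) :
    ∃ i : ℕ, 1 ≤ i ∧ i + 1 ≤ 2 ^ dyadicLevel t ∧ t = i / 2 ^ dyadicLevel t := by
  obtain ⟨⟨h0, h1⟩, l, i, hi⟩ := ht
  obtain ⟨m, hm⟩ : ∃ m : ℕ, t = cpt (dyadicLevel t) m :=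
    Nat.sInf_mem (s := {l' | ∃ m : ℕ, t = cpt l' m}) ⟨l, i, hi⟩
  have h2 : (0 : ℝ) < 2 ^ dyadicLevel t := by positivity
  unfold cpt at hm
  refine ⟨m, ?_, ?_, hm⟩
  · rw [hm, div_pos_iff_of_pos_right h2] at h0
    exact_mod_cast h0
  · have h1' : (m : ℝ) / 2 ^ dyadicLevel t < 1 := hm ▸ h1
    rw [div_lt_one h2] at h1'
    exact_mod_cast h1'

lemma IsDyadic.one_le_dyadicLevel {t : ℝ} (ht : IsDyadic t) : 1 ≤ dyadicLevel t := by
  obtain ⟨i, h1, h2, -⟩ := ht.exists_index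
  rcases Nat.eq_zero_or_pos (dyadicLevel t) with h | h
  · rw [h] at h2; omega
  · exact h

lemma IsDyadic.mesh_le {t : ℝ} (ht : IsDyadic t) : 0 ≤ t - mesh t ∧ t + mesh t ≤ 1 := by
  obtain ⟨i, h1, h2, h⟩ := ht.exists_index
  have hp : (0 : ℝ) < 2 ^ dyadicLevel t := by positivity
  have h1' : (1 : ℝ) ≤ i := by exact_mod_cast h1
  have h2' : (i : ℝ) + 1 ≤ 2 ^ dyadicLevel t := by exact_mod_cast h2
  have e1 : t - mesh t = (i - 1) / 2 ^ dyadicLevel t := by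
    unfold mesh; nth_rewrite 1 [h]; ring
  have e2 : t + mesh t = (i + 1) / 2 ^ dyadicLevel t := by
    unfold mesh; nth_rewrite 1 [h]; ring
  rw [e1, e2, div_le_one hp]
  exact ⟨div_nonneg (by linarith) hp.le, h2'⟩

lemma IsDyadic.exists_odd_index {t : ℝ} (ht : IsDyadic t) :
    ∃ L m : ℕ, dyadicLevel t = L + 1 ∧ t = (2 * m + 1) / 2 ^ (L + 1) := by
  obtain ⟨L, hL⟩ := Nat.exists_eq_add_of_le' ht.one_le_dyadicLevel
  obtain ⟨i, -, -, h⟩ := ht.exists_index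
  rw [hL] at h
  rcases Nat.even_or_odd' i with ⟨m, rfl | rfl⟩
  · have : t = cpt L m := by
      rw [h, cpt]; push_cast; rw [pow_succ]; field_simp
    have h' := dyadicLevel_cpt_le L m
    rw [← this] at h'
    omega
  · exact ⟨L, m, hL, by rw [h]; push_cast; rfl⟩

lemma IsNbr.isDyadic {s t : ℝ} (ht : IsDyadic t) (h : IsNbr s t) : IsDyadic s := by
  obtain ⟨hs, h⟩ := h
  refine ⟨hs, ?_⟩
  obtain ⟨i, h1, -, hi⟩ := ht.exists_index
  rcases h with rfl | rfl | rfl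
  · refine ⟨dyadicLevel t, i - 1, ?_⟩
    unfold cpt mesh; nth_rewrite 1 [hi]; push_cast [h1]; ring
  · exact ht.2
  · refine ⟨dyadicLevel t, i + 1, ?_⟩
    unfold cpt mesh; nth_rewrite 1 [hi]; push_cast; ring

lemma IsNbr.dyadicLevel_lt {s t : ℝ} (ht : IsDyadic t) (h : IsNbr s t) (hne : s ≠ t) :
    dyadicLevel s < dyadicLevel t := by
  obtain ⟨L, m, hL, hm⟩ := ht.exists_odd_index
  have hmesh : mesh t = 1 / 2 ^ (L + 1) := by rw [mesh, hL]
  have key : ∃ i : ℕ, s = cpt L i := by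
    rcases h.2 with rfl | rfl | rfl
    · refine ⟨m, ?_⟩
      rw [hmesh, hm, cpt, pow_succ]; field_simp; ring
    · exact absurd rfl hne
    · refine ⟨m + 1, ?_⟩
      rw [hmesh, hm, cpt, pow_succ]; push_cast; field_simp; ring
  obtain ⟨i, hi⟩ := key
  rw [hL, hi]
  exact Nat.lt_succ_of_le (dyadicLevel_cpt_le L i)

lemma IsNbr.dyadicLevel_le {s t : ℝ} (ht : IsDyadic t) (h : IsNbr s t) :
    dyadicLevel s ≤ dyadicLevel t := by
  by_cases hne : s = t
  · rw [hne]
  · exact (h.dyadicLevel_lt ht hne).le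

/-- If the level of `s` is at most that of `t`, distinct dyadic points `s`, `t` are at distance at least `2^{-l}`, where `l` is the level of `t`. -/
lemma IsDyadic.le_or_ge_of_dyadicLevel_le {s t : ℝ} (hs : IsDyadic s) (ht : IsDyadic t)
    (hle : dyadicLevel s ≤ dyadicLevel t) (hne : s ≠ t) :
    s ≤ t - mesh t ∨ t + mesh t ≤ s := by
  obtain ⟨i, -, -, hi⟩ := ht.exists_index
  obtain ⟨m, -, -, hm⟩ := hs.exists_index
  obtain ⟨e, he⟩ := Nat.exists_eq_add_of_le hle
  have hs' : s = ((m * 2 ^ e : ℕ) : ℝ) / 2 ^ dyadicLevel t := by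
    rw [he, pow_add]; nth_rewrite 1 [hm]; push_cast; field_simp
  generalize m * 2 ^ e = r at hs'
  have e1 : t - mesh t = (i - 1) / 2 ^ dyadicLevel t := by
    unfold mesh; nth_rewrite 1 [hi]; ring
  have e2 : t + mesh t = (i + 1) / 2 ^ dyadicLevel t := by
    unfold mesh; nth_rewrite 1 [hi]; ring
  rw [e1, e2, hs', div_le_div_iff_of_pos_right (by positivity),
    div_le_div_iff_of_pos_right (by positivity)]
  rcases lt_trichotomy r i with h | h | h
  · left
    have : (r : ℝ) + 1 ≤ i := by exact_mod_cast h
    linarith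
  · exact absurd (by rw [hs', h, ← hi]) hne
  · right; exact_mod_cast h

lemma isDyadic_cpt {l i : ℕ} (h1 : 1 ≤ i) (h2 : i ≤ 2 ^ l - 1) : IsDyadic (cpt l i) := by
  have hp : (0 : ℝ) < 2 ^ l := by positivity
  refine ⟨⟨?_, ?_⟩, l, i, rfl⟩
  · have : (0 : ℝ) < i := by exact_mod_cast h1
    unfold cpt; positivity
  · unfold cpt
    rw [div_lt_one hp]
    have : i < 2 ^ l := by have := Nat.one_le_two_pow (n := l); omega
    exact_mod_cast this

lemma mem_SGset_iff {d τ : ℕ} {x : Fin d → ℝ} :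
    x ∈ SGset d τ ↔ (∀ j, IsDyadic (x j)) ∧ ∑ j, dyadicLevel (x j) ≤ τ + d - 1 := by
  constructor
  · rintro ⟨l, -, hsum, hx⟩
    choose i h1 h2 hx using hx
    refine ⟨fun j => hx j ▸ isDyadic_cpt (h1 j) (h2 j), le_trans (Finset.sum_le_sum ?_) hsum⟩
    intro j _
    rw [hx j]
    exact dyadicLevel_cpt_le _ _
  · rintro ⟨hx, hsum⟩
    refine ⟨fun j => dyadicLevel (x j), fun j => (hx j).one_le_dyadicLevel, hsum, fun j => ?_⟩
    obtain ⟨i, h1, h2, h⟩ := (hx j).exists_index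
    exact ⟨i, h1, Nat.le_sub_one_of_lt h2, h⟩

/-- Coefficients of the locally supported combination of `k(a,·), k(t,·), k(b,·)` for a
one-dimensional Markov kernel `k(s,z) = p(min s z) q(max s z)`. -/
lemma exists_hat_coeffs {p q : ℝ → ℝ} (hp : ∀ x ∈ Set.Ioo (0 : ℝ) 1, 0 < p x)
    (hq : ∀ x ∈ Set.Ioo (0 : ℝ) 1, 0 < q x)
    (hdet : ∀ y ∈ Set.Icc (0 : ℝ) 1, ∀ x ∈ Set.Icc (0 : ℝ) 1, y < x → 0 < p x * q y - p y * q x)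
    {a t b : ℝ} (ha : 0 ≤ a) (hat : a < t) (htb : t < b) (hb : b ≤ 1) :
    ∃ α β γ : ℝ, β ≠ 0 ∧ (a = 0 → α = 0) ∧ (b = 1 → γ = 0) ∧
      (∀ z ∈ Set.Ioo (0 : ℝ) 1, z ≤ a ∨ b ≤ z →
        p (min z a) * q (max z a) * α + p (min z t) * q (max z t) * β +
          p (min z b) * q (max z b) * γ = 0) ∧
      p (min t a) * q (max t a) * α + p (min t t) * q (max t t) * β +
          p (min t b) * q (max t b) * γ ≠ 0 := by
  have hpt := hp t ⟨by linarith, by linarith⟩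
  have hqt := hq t ⟨by linarith, by linarith⟩
  have d1 := hdet a ⟨by linarith, by linarith⟩ t ⟨by linarith, by linarith⟩ hat
  have d2 := hdet t ⟨by linarith, by linarith⟩ b ⟨by linarith, by linarith⟩ htb
  have d3 := hdet a ⟨by linarith, by linarith⟩ b ⟨by linarith, by linarith⟩ (hat.trans htb)
  simp only [min_self, max_self, min_eq_right hat.le, max_eq_left hat.le, min_eq_left htb.le,
    max_eq_right htb.le]
  have left : ∀ z, z ≤ a → min z a = z ∧ max z a = a ∧ min z t = z ∧ max z t = t ∧
      min z b = z ∧ max z b = b := fun z hz =>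
    ⟨min_eq_left hz, max_eq_right hz, min_eq_left (by linarith), max_eq_right (by linarith),
      min_eq_left (by linarith), max_eq_right (by linarith)⟩
  have right : ∀ z, b ≤ z → min z a = a ∧ max z a = z ∧ min z t = t ∧ max z t = z ∧
      min z b = b ∧ max z b = z := fun z hz =>
    ⟨min_eq_right (by linarith), max_eq_left (by linarith), min_eq_right (by linarith),
      max_eq_left (by linarith), min_eq_right hz, max_eq_left hz⟩
  rcases ha.eq_or_lt with ha0 | ha0 <;> rcases hb.eq_or_lt with hb1 | hb1
  · refine ⟨0, 1, 0, one_ne_zero, fun _ => rfl, fun _ => rfl, ?_, ?_⟩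
    · rintro z ⟨hz0, hz1⟩ (hz | hz) <;> linarith
    · have := mul_pos hpt hqt
      intro h; linarith
  · refine ⟨0, p b, -p t, (hp b ⟨by linarith, hb1⟩).ne', fun _ => rfl,
      fun h => absurd h hb1.ne, ?_, ?_⟩
    · rintro z ⟨hz0, hz1⟩ (hz | hz)
      · linarith
      · obtain ⟨h1, h2, h3, h4, h5, h6⟩ := right z hz
        rw [h1, h2, h3, h4, h5, h6]; ring
    · have := mul_pos hpt d2
      intro h; linarith
  · refine ⟨q t, -q a, 0, neg_ne_zero.2 (hq a ⟨ha0, by linarith⟩).ne',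
      fun h => absurd h ha0.ne', fun _ => rfl, ?_, ?_⟩
    · rintro z ⟨hz0, hz1⟩ (hz | hz)
      · obtain ⟨h1, h2, h3, h4, h5, h6⟩ := left z hz
        rw [h1, h2, h3, h4, h5, h6]; ring
      · linarith
    · have := mul_pos hqt d1
      intro h; linarith
  · refine ⟨q t * p b - q b * p t, q b * p a - q a * p b, q a * p t - q t * p a,
      by intro h; linarith, fun h => absurd h ha0.ne', fun h => absurd h hb1.ne, ?_, ?_⟩
    · rintro z ⟨hz0, hz1⟩ (hz | hz)
      · obtain ⟨h1, h2, h3, h4, h5, h6⟩ := left z hz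
        rw [h1, h2, h3, h4, h5, h6]; ring
      · obtain ⟨h1, h2, h3, h4, h5, h6⟩ := right z hz
        rw [h1, h2, h3, h4, h5, h6]; ring
    · have := mul_pos d1 d2
      intro h; linarith

/-- A hat function centred at a dyadic point `t`, as a combination of the kernel at the
neighbours of `t`. -/
lemma TMKernelSL.exists_hat {d : ℕ} (κ : TMKernelSL d) (j : Fin d) {t : ℝ} (ht : IsDyadic t) :
    ∃ (N : Finset ℝ) (v : ℝ → ℝ), (∀ s ∈ N, IsNbr s t) ∧ (∀ s ∉ N, v s = 0) ∧ v t ≠ 0 ∧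
      (∀ z ∈ Set.Ioo (0 : ℝ) 1, z ≤ t - mesh t ∨ t + mesh t ≤ z →
        ∑ s ∈ N, κ.k1 j z s * v s = 0) ∧
      ∑ s ∈ N, κ.k1 j t s * v s ≠ 0 := by
  classical
  have hm := mesh_pos t
  obtain ⟨ha, hb⟩ := ht.mesh_le
  have hat : t - mesh t < t := by linarith
  have htb : t < t + mesh t := by linarith
  obtain ⟨α, β, γ, hβ, hα, hγ, hz, hne⟩ :=
    exists_hat_coeffs (κ.pos_p j) (κ.pos_q j) (κ.det_pos j) ha hat htb hb
  have hIoo := ht.1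
  set a := t - mesh t with ha_def
  set b := t + mesh t with hb_def
  let v : ℝ → ℝ := fun s => if s = a then α else if s = t then β else if s = b then γ else 0
  have va : v a = α := if_pos rfl
  have vt : v t = β := by simp only [v, if_neg hat.ne', if_true]
  have vb : v b = γ := by simp only [v, if_neg htb.ne', if_neg (hat.trans htb).ne', if_true]
  have hv : ∀ s ∈ ({a, t, b} : Finset ℝ), s ∉ Set.Ioo (0 : ℝ) 1 → v s = 0 := by
    intro s hs hs'
    simp only [Finset.mem_insert, Finset.mem_singleton] at hs
    rcases hs with rfl | rfl | rfl
    · rw [va]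
      refine hα (le_antisymm ?_ ha)
      by_contra! h
      exact hs' ⟨h, by linarith⟩
    · exact absurd hIoo hs'
    · rw [vb]
      refine hγ (le_antisymm hb ?_)
      by_contra! h
      exact hs' ⟨by linarith, h⟩
  have hsum : ∀ z, ∑ s ∈ ({a, t, b} : Finset ℝ).filter (· ∈ Set.Ioo (0 : ℝ) 1),
      κ.k1 j z s * v s = κ.k1 j z a * α + κ.k1 j z t * β + κ.k1 j z b * γ := by
    intro z
    rw [Finset.sum_filter_of_ne, Finset.sum_insert, Finset.sum_insert, Finset.sum_singleton,
      va, vt, vb, add_assoc]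
    · simpa using htb.ne
    · simpa using ⟨hat.ne, (hat.trans htb).ne⟩
    · intro s hs h
      by_contra h'
      exact h (by rw [hv s hs h', mul_zero])
  refine ⟨({a, t, b} : Finset ℝ).filter (· ∈ Set.Ioo (0 : ℝ) 1), v, ?_, ?_, vt ▸ hβ, ?_, ?_⟩
  · intro s hs
    simp only [Finset.mem_filter, Finset.mem_insert, Finset.mem_singleton] at hs
    exact ⟨hs.2, hs.1⟩
  · intro s hs
    by_cases h : s ∈ ({a, t, b} : Finset ℝ)
    · exact hv s h fun h' => hs (Finset.mem_filter.2 ⟨h, h'⟩)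
    · simp only [Finset.mem_insert, Finset.mem_singleton, not_or] at h
      simp only [v, if_neg h.1, if_neg h.2.1, if_neg h.2.2]
  · intro z hz01 hz'
    rw [hsum]
    exact hz z hz01 hz'
  · rw [hsum]
    exact hne

/-- On a finite set of dyadic points that is closed under taking neighbours, a nonzero entry of
the inverse kernel matrix forces the two points to be neighbours of a common design point. -/
lemma TMKernelSL.exists_common_isNbr_of_inv_ne_zero {d : ℕ} (κ : TMKernelSL d)
    {X : Finset (Fin d → ℝ)} (hX : ∀ x ∈ X, ∀ j, IsDyadic (x j))
    (hclosed : ∀ x ∈ X, ∀ s : Fin d → ℝ, (∀ j, IsNbr (s j) (x j)) → s ∈ X) (y' y'' : X)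
    (h : (Matrix.of fun a b : X => κ.k a b)⁻¹ y' y'' ≠ 0) :
    ∃ x ∈ X, ∀ j, IsNbr (y'.1 j) (x j) ∧ IsNbr (y''.1 j) (x j) := by
  classical
  have hhat := fun (j : Fin d) (t : ℝ) (ht : IsDyadic t) => κ.exists_hat j ht
  choose! N v hN hv hvt hφ hφt using hhat
  set K : Matrix X X ℝ := Matrix.of fun a b : X => κ.k a b with hK
  let V : Matrix X X ℝ := Matrix.of fun s x : X => ∏ j, v j (x.1 j) (s.1 j)
  have hVapply : ∀ s x : X, V s x = ∏ j, v j (x.1 j) (s.1 j) := fun _ _ => rfl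
  have hVnbr : ∀ s x : X, V s x ≠ 0 → ∀ j, IsNbr (s.1 j) (x.1 j) := by
    intro s x hsx j
    rw [hVapply] at hsx
    have hj := Finset.prod_ne_zero_iff.1 hsx j (Finset.mem_univ j)
    refine hN j _ (hX _ x.2 j) _ ?_
    by_contra hnot
    exact hj (hv j _ (hX _ x.2 j) _ hnot)
  have hKsymm : Kᵀ = K := by
    ext x y
    simp only [hK, Matrix.transpose_apply, Matrix.of_apply, TMKernelSL.k, min_comm, max_comm]
  have hKV : ∀ z y : X, (K * V) z y =
      ∏ j, ∑ s ∈ N j (y.1 j), κ.k1 j (z.1 j) s * v j (y.1 j) s := by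
    intro z y
    rw [Finset.prod_univ_sum, Matrix.mul_apply]
    have hterm : ∀ s : X, K z s * V s y =
        (fun w : Fin d → ℝ => ∏ j, κ.k1 j (z.1 j) (w j) * v j (y.1 j) (w j)) s := by
      intro s
      simp only [hK, V, Matrix.of_apply, TMKernelSL.k, TMKernelSL.k1, Finset.prod_mul_distrib]
    rw [Finset.sum_congr rfl fun s _ => hterm s, Finset.sum_coe_sort X
      fun w : Fin d → ℝ => ∏ j, κ.k1 j (z.1 j) (w j) * v j (y.1 j) (w j)]
    symm
    refine Finset.sum_subset ?_ ?_
    · intro w hw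
      rw [Fintype.mem_piFinset] at hw
      exact hclosed _ y.2 w fun j => hN j _ (hX _ y.2 j) _ (hw j)
    · intro w _ hw
      rw [Fintype.mem_piFinset] at hw
      push Not at hw
      obtain ⟨j, hj⟩ := hw
      refine Finset.prod_eq_zero (Finset.mem_univ j) ?_
      rw [hv j _ (hX _ y.2 j) _ hj, mul_zero]
  have hKV0 : ∀ z y : X, ∀ j, dyadicLevel (z.1 j) ≤ dyadicLevel (y.1 j) → z.1 j ≠ y.1 j →
      (K * V) z y = 0 := by
    intro z y j hle hne
    rw [hKV]
    refine Finset.prod_eq_zero (Finset.mem_univ j) ?_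
    exact hφ j _ (hX _ y.2 j) _ (hX _ z.2 j).1
      ((hX _ z.2 j).le_or_ge_of_dyadicLevel_le (hX _ y.2 j) hle hne)
  have hW : ∀ x y : X, ∀ j, dyadicLevel (x.1 j) ≤ dyadicLevel (y.1 j) → x.1 j ≠ y.1 j →
      (Vᵀ * (K * V)) x y = 0 := by
    intro x y j hle hne
    rw [Matrix.mul_apply]
    refine Finset.sum_eq_zero fun z _ => ?_
    by_cases hz : V z x = 0
    · rw [Matrix.transpose_apply, hz, zero_mul]
    · have hnb := hVnbr z x hz j
      rw [hKV0 z y j ((hnb.dyadicLevel_le (hX _ x.2 j)).trans hle), mul_zero]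
      intro heq
      by_cases hzx : z.1 j = x.1 j
      · exact hne (hzx ▸ heq)
      · have := hnb.dyadicLevel_lt (hX _ x.2 j) hzx
        rw [heq] at this
        omega
  have hWsymm : (Vᵀ * (K * V))ᵀ = Vᵀ * (K * V) := by
    rw [Matrix.transpose_mul, Matrix.transpose_mul, Matrix.transpose_transpose, hKsymm,
      Matrix.mul_assoc]
  have hWne : ∀ x y : X, x ≠ y → (Vᵀ * (K * V)) x y = 0 := by
    intro x y hxy
    obtain ⟨j, hj⟩ : ∃ j, x.1 j ≠ y.1 j := by
      by_contra! hall
      exact hxy (Subtype.ext (funext hall))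
    rcases le_total (dyadicLevel (x.1 j)) (dyadicLevel (y.1 j)) with hle | hle
    · exact hW x y j hle hj
    · rw [← hWsymm, Matrix.transpose_apply]
      exact hW y x j hle hj.symm
  have hWdiag : ∀ x : X, (Vᵀ * (K * V)) x x ≠ 0 := by
    intro x
    rw [Matrix.mul_apply, Finset.sum_eq_single x]
    · rw [Matrix.transpose_apply, hKV, hVapply]
      refine mul_ne_zero (Finset.prod_ne_zero_iff.2 fun j _ => hvt j _ (hX _ x.2 j))
        (Finset.prod_ne_zero_iff.2 fun j _ => hφt j _ (hX _ x.2 j))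
    · intro z _ hzx
      by_cases hz : V z x = 0
      · rw [Matrix.transpose_apply, hz, zero_mul]
      · obtain ⟨j, hj⟩ : ∃ j, z.1 j ≠ x.1 j := by
          by_contra! hall
          exact hzx (Subtype.ext (funext hall))
        rw [hKV0 z x j ((hVnbr z x hz j).dyadicLevel_le (hX _ x.2 j)) hj, mul_zero]
    · exact fun hx => absurd (Finset.mem_univ x) hx
  let D : X → ℝ := fun x => (Vᵀ * (K * V)) x x
  have hWD : Vᵀ * (K * V) = Matrix.diagonal D := by
    ext x y
    by_cases hxy : x = y
    · subst hxy; rw [Matrix.diagonal_apply_eq]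
    · rw [Matrix.diagonal_apply_ne _ hxy, hWne x y hxy]
  have hleft : (Matrix.diagonal (fun x => (D x)⁻¹) * Vᵀ * K) * V = 1 := by
    rw [Matrix.mul_assoc, Matrix.mul_assoc, hWD, Matrix.diagonal_mul_diagonal,
      ← Matrix.diagonal_one]
    congr 1
    funext x
    exact inv_mul_cancel₀ (hWdiag x)
  have hinv : K⁻¹ = V * (Matrix.diagonal (fun x => (D x)⁻¹) * Vᵀ) := by
    refine Matrix.inv_eq_left_inv ?_
    rw [Matrix.mul_assoc]
    exact mul_eq_one_comm.1 hleft
  rw [hinv, Matrix.mul_apply] at h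
  obtain ⟨x, -, hx⟩ := Finset.exists_ne_zero_of_sum_ne_zero h
  rw [Matrix.diagonal_mul, Matrix.transpose_apply] at hx
  refine ⟨x.1, x.2, fun j => ⟨hVnbr _ _ (left_ne_zero_of_mul hx) j,
    hVnbr _ _ (right_ne_zero_of_mul (right_ne_zero_of_mul hx)) j⟩⟩

/-- A design point outside the sparse grid of level `τ` is a neighbour of no other point of the
sparse grid of level `τ + 1`. -/
lemma eq_of_isNbr_of_notMem_SGset {d τ : ℕ} {s x : Fin d → ℝ} (hx : x ∈ SGset d (τ + 1))
    (hs : s ∉ SGset d τ) (hnbr : ∀ j, IsNbr (s j) (x j)) : s = x := by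
  rw [mem_SGset_iff] at hx hs
  have hsum : τ + d - 1 < ∑ j, dyadicLevel (s j) := by
    by_contra! hle
    exact hs ⟨fun j => (hnbr j).isDyadic (hx.1 j), hle⟩
  by_contra hne
  obtain ⟨j, hj⟩ : ∃ j, s j ≠ x j := Function.ne_iff.1 hne
  have : ∑ j, dyadicLevel (s j) < ∑ j, dyadicLevel (x j) :=
    Finset.sum_lt_sum (fun i _ => (hnbr i).dyadicLevel_le (hx.1 i))
      ⟨j, Finset.mem_univ j, (hnbr j).dyadicLevel_lt (hx.1 j) hj⟩
  omega

/-- A point is within one mesh width of each of its neighbours, at the level of the neighbour. -/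
lemma IsNbr.abs_sub_lt_mesh {s t : ℝ} (ht : IsDyadic t) (h : IsNbr s t) : |t - s| < mesh s := by
  by_cases hne : s = t
  · rw [hne, sub_self, abs_zero]; exact mesh_pos t
  · have hlt : mesh t < mesh s :=
      one_div_lt_one_div_of_lt (by positivity)
        (pow_lt_pow_right₀ one_lt_two (h.dyadicLevel_lt ht hne))
    have hm := mesh_pos t
    rcases h.2 with h | h | h
    · rw [abs_lt]; constructor <;> linarith
    · exact absurd h hne
    · rw [abs_lt]; constructor <;> linarith

/-- Two neighbours of a common dyadic point differ by at most one step of the uniform grid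
whose level is the larger of theirs. -/
lemma IsNbr.abs_sub_mul_le {s s' t : ℝ} (ht : IsDyadic t) (h : IsNbr s t) (h' : IsNbr s' t) :
    |s - s'| * 2 ^ max (dyadicLevel s) (dyadicLevel s') ≤ 1 := by
  have hm := mesh_pos t
  have hmul : mesh t * 2 ^ dyadicLevel t = 1 := one_div_mul_cancel (by positivity)
  have bound : ∀ r, IsNbr r t → |r - t| ≤ mesh t := by
    rintro r ⟨-, h | h | h⟩ <;> rw [h, abs_le] <;> constructor <;> linarith
  have hmax : max (dyadicLevel s) (dyadicLevel s') ≤ dyadicLevel t :=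
    max_le (h.dyadicLevel_le ht) (h'.dyadicLevel_le ht)
  by_cases hs : s = t ∨ s' = t
  · have hd : |s - s'| ≤ mesh t := by
      rcases hs with rfl | rfl
      · rw [abs_sub_comm]; exact bound _ h'
      · exact bound _ h
    calc |s - s'| * 2 ^ max (dyadicLevel s) (dyadicLevel s')
        ≤ mesh t * 2 ^ dyadicLevel t := by
          gcongr
          exact one_le_two
      _ = 1 := hmul
  · push Not at hs
    have hlt : max (dyadicLevel s) (dyadicLevel s') + 1 ≤ dyadicLevel t :=
      max_lt (h.dyadicLevel_lt ht hs.1) (h'.dyadicLevel_lt ht hs.2)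
    have hd : |s - s'| ≤ mesh t * 2 := by
      have h1 := abs_le.1 (bound _ h)
      have h2 := abs_le.1 (bound _ h')
      rw [abs_le]; constructor <;> linarith
    calc |s - s'| * 2 ^ max (dyadicLevel s) (dyadicLevel s')
        ≤ mesh t * 2 * 2 ^ max (dyadicLevel s) (dyadicLevel s') := by gcongr
      _ = mesh t * 2 ^ (max (dyadicLevel s) (dyadicLevel s') + 1) := by ring
      _ ≤ mesh t * 2 ^ dyadicLevel t := by
          gcongr
          exact one_le_two
      _ = 1 := hmul

lemma cpoint_mem_hyperRect_of_isNbr {d : ℕ} {l i : Fin d → ℕ} (hi : i ∈ rho l)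
    {x : Fin d → ℝ} (hx : ∀ j, IsDyadic (x j)) (hnbr : ∀ j, IsNbr (cpoint l i j) (x j)) :
    x ∈ hyperRect l i := by
  intro j
  have h := (hnbr j).abs_sub_lt_mesh (hx j)
  have h1 := (hi j).2.1
  rw [cpoint, mesh, dyadicLevel_cpt_of_odd (hi j).1, abs_lt] at h
  have e1 : cpt (l j) (i j - 1) = cpt (l j) (i j) - 1 / 2 ^ l j := by
    unfold cpt; push_cast [h1]; ring
  have e2 : cpt (l j) (i j + 1) = cpt (l j) (i j) + 1 / 2 ^ l j := by
    unfold cpt; push_cast; ring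
  rw [e1, e2]
  constructor <;> linarith

lemma abs_index_sub_le_one {l i l' i' : ℕ} (hi : Odd i) (hi' : Odd i') {t : ℝ} (ht : IsDyadic t)
    (h : IsNbr (cpt l i) t) (h' : IsNbr (cpt l' i') t) :
    |(i : ℤ) * 2 ^ (max l l' - l) - (i' : ℤ) * 2 ^ (max l l' - l')| ≤ 1 := by
  have key := h.abs_sub_mul_le ht h'
  rw [dyadicLevel_cpt_of_odd hi, dyadicLevel_cpt_of_odd hi'] at key
  have scale : ∀ k m M : ℕ, k ≤ M → cpt k m * 2 ^ M = (m : ℝ) * 2 ^ (M - k) := by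
    intro k m M hkM
    obtain ⟨e, rfl⟩ := Nat.exists_eq_add_of_le hkM
    rw [cpt, Nat.add_sub_cancel_left, pow_add]
    field_simp
  have hpow : (0 : ℝ) < 2 ^ max l l' := by positivity
  rw [← abs_of_pos hpow, ← abs_mul, sub_mul, scale _ _ _ (le_max_left _ _),
    scale _ _ _ (le_max_right _ _)] at key
  exact_mod_cast key

/-- **Theorem 5(ii), Ding & Zhang.** Sufficient conditions for entries of the inverse kernel
matrix on a truncated sparse grid to vanish: for design points `c_{l',i'}, c_{l'',i''}` of
the TSG `X = X_τ^SG ∪ A` (with canonical indices), if (a) both lie in `A` and are distinct,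
or (b) `c_{l',i'} ∈ X_τ^SG`, `c_{l'',i''} ∈ A` and `c_{l'',i''} ∉ R_{l',i'}`, or (c) both lie
in `X_τ^SG`, `|i'_j 2^{max(l'_j,l''_j)−l'_j} − i''_j 2^{max(l'_j,l''_j)−l''_j}| ≥ 2` for some
`j`, and no point of `A` lies in `R_{l',i'} ∩ R_{l'',i''}`, then the corresponding entries of
`K⁻¹` are zero. -/
theorem tsg_kernel_matrix_inverse_zero_entries
    (d : ℕ) (hd : 1 ≤ d) (κ : TMKernelSL d)
    (n τ : ℕ) (hn : 3 ≤ n) (hτ : 1 ≤ τ)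
    (X : Finset (Fin d → ℝ)) (hXcard : X.card = n)
    (hX1 : SGset d τ ⊆ ↑X) (hX2 : ↑X ⊆ SGset d (τ + 1))
    (hn1 : (SGset d τ).ncard ≤ n) (hn2 : n < (SGset d (τ + 1)).ncard)
    (K : Matrix ↥X ↥X ℝ) (hK : K = Matrix.of fun (a b : ↥X) => κ.k ↑a ↑b)
    (l' i' l'' i'' : Fin d → ℕ)
    (hl' : ∀ j, 1 ≤ l' j) (hi' : i' ∈ rho l')
    (hl'' : ∀ j, 1 ≤ l'' j) (hi'' : i'' ∈ rho l'')
    (y' y'' : ↥X)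
    (hy' : (y' : Fin d → ℝ) = cpoint l' i') (hy'' : (y'' : Fin d → ℝ) = cpoint l'' i'')
    (hcond :
      (cpoint l' i' ∈ (↑X : Set (Fin d → ℝ)) \ SGset d τ ∧
        cpoint l'' i'' ∈ (↑X : Set (Fin d → ℝ)) \ SGset d τ ∧
        cpoint l' i' ≠ cpoint l'' i'') ∨
      (cpoint l' i' ∈ SGset d τ ∧
        cpoint l'' i'' ∈ (↑X : Set (Fin d → ℝ)) \ SGset d τ ∧
        cpoint l'' i'' ∉ hyperRect l' i') ∨
      (cpoint l' i' ∈ SGset d τ ∧ cpoint l'' i'' ∈ SGset d τ ∧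
        (∃ j, 2 ≤ |(i' j : ℤ) * 2 ^ (max (l' j) (l'' j) - l' j) -
          (i'' j : ℤ) * 2 ^ (max (l' j) (l'' j) - l'' j)|) ∧
        ∀ a ∈ (↑X : Set (Fin d → ℝ)) \ SGset d τ,
          a ∉ hyperRect l' i' ∩ hyperRect l'' i'')) :
    K⁻¹ y' y'' = 0 ∧ K⁻¹ y'' y' = 0 := by
  have hX : ∀ x ∈ X, ∀ j, IsDyadic (x j) := fun x hx => (mem_SGset_iff.1 (hX2 hx)).1
  have hclosed : ∀ x ∈ X, ∀ s : Fin d → ℝ, (∀ j, IsNbr (s j) (x j)) → s ∈ X := by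
    intro x hx s hs
    by_cases hsτ : s ∈ SGset d τ
    · exact hX1 hsτ
    · rwa [eq_of_isNbr_of_notMem_SGset (hX2 hx) hsτ hs]
  have key : ∀ x ∈ X, (∀ j, IsNbr (y'.1 j) (x j)) → (∀ j, IsNbr (y''.1 j) (x j)) → False := by
    intro x hx h' h''
    rw [hy'] at h'
    rw [hy''] at h''
    rcases hcond with ⟨ha', ha'', hne⟩ | ⟨-, ha'', hR⟩ | ⟨-, -, ⟨j, hj⟩, -⟩
    · exact hne ((eq_of_isNbr_of_notMem_SGset (hX2 hx) ha'.2 h').trans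
        (eq_of_isNbr_of_notMem_SGset (hX2 hx) ha''.2 h'').symm)
    · rw [eq_of_isNbr_of_notMem_SGset (hX2 hx) ha''.2 h''] at hR
      exact hR (cpoint_mem_hyperRect_of_isNbr hi' (hX x hx) h')
    · have := abs_index_sub_le_one (hi' j).1 (hi'' j).1 (hX x hx j) (h' j) (h'' j)
      omega
  subst hK
  constructor
  · by_contra hne
    obtain ⟨x, hx, h⟩ := κ.exists_common_isNbr_of_inv_ne_zero hX hclosed y' y'' hne
    exact key x hx (fun j => (h j).1) (fun j => (h j).2)
  · by_contra hne
    obtain ⟨x, hx, h⟩ := κ.exists_common_isNbr_of_inv_ne_zero hX hclosed y'' y' hne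
    exact key x hx (fun j => (h j).2) (fun j => (h j).1)
end

section
/- Let k be a tensor Markov kernel on (0,1)^d satisfying Assumption SL. There exists a constant C > 0, depending only on k and d, such that for every n ≥ 2, every truncated sparse grid design {x_1,…,x_n} of size n, every λ > 0, and every x ∈ (0,1)^d: 0 ≤ k(x)^⊤ K^{-1} k(x) − k(x)^⊤ (K + λ I_n)^{-1} k(x) ≤ C · λ^{1/2} · (log n)^d, where I_n is the n×n identity matrix. -/
open Matrix

theorem dotProduct_inv_sub_regularized_bounds {ι : Type*} [Fintype ι] [DecidableEq ι]
    {K : Matrix ι ι ℝ} (hK : K.PosSemidef)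
    (hKu : IsUnit K) {k a : ι → ℝ} (ha : K *ᵥ a = k) {V A lam : ℝ} (hlam : 0 < lam)
    (hV : k ⬝ᵥ a ≤ V) (hA : ∑ i, |a i| ≤ A) :
    0 ≤ k ⬝ᵥ (K⁻¹ *ᵥ k) - k ⬝ᵥ ((K + lam • (1 : Matrix ι ι ℝ))⁻¹ *ᵥ k) ∧
      k ⬝ᵥ (K⁻¹ *ᵥ k) - k ⬝ᵥ ((K + lam • (1 : Matrix ι ι ℝ))⁻¹ *ᵥ k) ≤
        √V * √lam * A := by
  have hdet : IsUnit K.det := (Matrix.isUnit_iff_isUnit_det K).1 hKu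
  have hKa : K⁻¹ *ᵥ k = a := by
    rw [← ha, mulVec_mulVec, nonsing_inv_mul _ hdet, one_mulVec]
  have hG : (K + lam • (1 : Matrix ι ι ℝ)).PosDef :=
    Matrix.PosDef.posSemidef_add hK (Matrix.PosDef.one.smul hlam)
  have hGdet : IsUnit (K + lam • (1 : Matrix ι ι ℝ)).det :=
    (Matrix.isUnit_iff_isUnit_det _).1 hG.isUnit
  set b := (K + lam • (1 : Matrix ι ι ℝ))⁻¹ *ᵥ k with hb
  have hGb : K *ᵥ b + lam • b = k := by
    have : (K + lam • (1 : Matrix ι ι ℝ)) *ᵥ b = k := by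
      rw [hb, mulVec_mulVec, mul_nonsing_inv _ hGdet, one_mulVec]
    rwa [add_mulVec, smul_mulVec, one_mulVec] at this
  have hsymm : ∀ x y : ι → ℝ, (K *ᵥ x) ⬝ᵥ y = x ⬝ᵥ (K *ᵥ y) := by
    intro x y
    have hT : Kᵀ = K := by simpa using hK.isHermitian.eq
    rw [dotProduct_mulVec, ← mulVec_transpose, hT]
  have hquad : ∀ y : ι → ℝ, 0 ≤ y ⬝ᵥ (K *ᵥ y) := fun y => by
    simpa using hK.dotProduct_mulVec_nonneg y
  have hres : K *ᵥ (a - b) = lam • b := by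
    rw [mulVec_sub, ha, ← hGb]; abel
  have hgap : k ⬝ᵥ a - k ⬝ᵥ b = lam * (a ⬝ᵥ b) := by
    rw [← dotProduct_sub, ← ha, hsymm, hres, dotProduct_smul, smul_eq_mul]
  have hab : lam * (b ⬝ᵥ b) ≤ lam * (a ⬝ᵥ b) := by
    have h1 := hquad (a - b)
    rw [hres, dotProduct_smul, smul_eq_mul, sub_dotProduct] at h1
    linarith
  have hkb : 0 ≤ k ⬝ᵥ b := by
    rw [← hGb, add_dotProduct, hsymm, smul_dotProduct, smul_eq_mul]
    have h1 : 0 ≤ b ⬝ᵥ b := Finset.sum_nonneg fun i _ => mul_self_nonneg (b i)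
    have := hquad b
    positivity
  have hbb : 0 ≤ b ⬝ᵥ b := Finset.sum_nonneg fun i _ => mul_self_nonneg (b i)
  have hgap0 : 0 ≤ k ⬝ᵥ a - k ⬝ᵥ b := by
    rw [hgap]; exact le_trans (by positivity) hab
  rw [hKa]
  refine ⟨hgap0, ?_⟩
  set γ := k ⬝ᵥ a - k ⬝ᵥ b with hγ
  have hA0 : 0 ≤ A := le_trans (Finset.sum_nonneg fun i _ => abs_nonneg _) hA
  have haa : a ⬝ᵥ a ≤ A ^ 2 := by
    calc a ⬝ᵥ a = ∑ i, |a i| ^ 2 := by simp [dotProduct, sq]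
      _ ≤ (∑ i, |a i|) ^ 2 := Finset.sum_sq_le_sq_sum_of_nonneg fun i _ => abs_nonneg _
      _ ≤ A ^ 2 := by gcongr
  have hcs : (a ⬝ᵥ b) ^ 2 ≤ (a ⬝ᵥ a) * (b ⬝ᵥ b) := by
    have := Finset.sum_mul_sq_le_sq_mul_sq Finset.univ a b
    simpa [dotProduct, sq] using this
  have hγA : γ ≤ lam * A ^ 2 := by
    by_contra! hcon
    have hpos : 0 < γ := lt_of_le_of_lt (by positivity) hcon
    have h1 : γ ^ 2 ≤ lam * A ^ 2 * γ := by
      calc γ ^ 2 = lam ^ 2 * (a ⬝ᵥ b) ^ 2 := by rw [hgap]; ring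
        _ ≤ lam ^ 2 * ((a ⬝ᵥ a) * (b ⬝ᵥ b)) := by gcongr
        _ = lam * (a ⬝ᵥ a) * (lam * (b ⬝ᵥ b)) := by ring
        _ ≤ lam * A ^ 2 * γ := by
          rw [hgap]; gcongr
    nlinarith
  have hγV : γ ≤ V := by linarith
  have hV0 : 0 ≤ V := hgap0.trans hγV
  refine abs_le_of_sq_le_sq' ?_ (by positivity) |>.2
  rw [mul_pow, mul_pow, Real.sq_sqrt hV0, Real.sq_sqrt hlam.le]
  nlinarith [mul_le_mul hγV hγA hgap0 hV0]

/-- Bessel's inequality for the Gram matrix of finitely many points together with one more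
point. -/
theorem dotProduct_le_of_gram_posSemidef {ι : Type*} [Fintype ι] {E : Type*} (k : E → E → ℝ)
    (hk : ∀ s : Option ι → E, (Matrix.of fun i j => k (s i) (s j)).PosSemidef)
    (z : E) (x : ι → E) {a : ι → ℝ}
    (ha : (Matrix.of fun i j => k (x i) (x j)) *ᵥ a = fun i => k z (x i)) :
    (fun i => k z (x i)) ⬝ᵥ a ≤ k z z := by
  have hP := hk (fun o => o.elim z x)
  have hs : ∀ i, k (x i) z = k z (x i) := fun i => by
    simpa using hP.isHermitian.apply none (some i)
  have h := hP.dotProduct_mulVec_nonneg (fun o => o.elim (-1) a)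
  have ha' : ∀ i, ∑ j, k (x i) (x j) * a j = k z (x i) := fun i => congrFun ha i
  simp only [dotProduct, mulVec, Matrix.of_apply, Pi.star_apply, star_trivial,
    Fintype.sum_option, Option.elim_none, Option.elim_some, ha', hs] at h
  simp only [dotProduct]
  have e : ∑ i, a i * (k z (x i) * -1 + k z (x i)) = 0 := by simp
  rw [e] at h
  linarith

theorem posSemidef_min {ι : Type*} [Finite ι] (r : ι → ℝ) (hr : ∀ i, 0 ≤ r i) :
    (Matrix.of fun i j => min (r i) (r j)).PosSemidef := by
  have h := MeasureTheory.posSemidef_matrix_measure_inter (μ := MeasureTheory.volume)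
    (s := fun i => Set.Ioc 0 (r i)) (fun i => measurableSet_Ioc) (fun i => by simp)
  convert! h using 3 with i j
  ext j
  rw [Set.Ioc_inter_Ioc]
  simp [hr]

theorem posSemidef_vecMulVec_self {ι : Type*} [Finite ι] (w : ι → ℝ) :
    (Matrix.of fun i j => w i * w j).PosSemidef := by
  have := Fintype.ofFinite ι
  have h := Matrix.posSemidef_vecMulVec_self_star w
  convert! h using 1

theorem posSemidef_finset_prod {ι J : Type*} [Finite ι] (s : Finset J) (f : J → ι → ι → ℝ)
    (hf : ∀ j ∈ s, (Matrix.of (f j)).PosSemidef) :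
    (Matrix.of fun a b => ∏ j ∈ s, f j a b).PosSemidef := by
  classical
  induction s using Finset.induction_on with
  | empty => simpa using posSemidef_vecMulVec_self (fun _ : ι => (1 : ℝ))
  | insert j s hj ih =>
    have h := (hf j (Finset.mem_insert_self j s)).hadamard
      (ih fun i hi => hf i (Finset.mem_insert_of_mem hi))
    convert! h using 1
    ext a b
    simp [Finset.prod_insert hj]

theorem TMKernelSL.posSemidef_gram {d : ℕ} (κ : TMKernelSL d) {ι : Type*} [Finite ι]
    (x : ι → Fin d → ℝ) (hx : ∀ a j, x a j ∈ Set.Ioo (0 : ℝ) 1) :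
    (Matrix.of fun a b => κ.k (x a) (x b)).PosSemidef := by
  refine posSemidef_finset_prod Finset.univ
    (fun j a b => κ.p j (min (x a j) (x b j)) * κ.q j (max (x a j) (x b j))) fun j _ => ?_
  have h := (posSemidef_vecMulVec_self fun a => κ.q j (x a j)).hadamard
    (posSemidef_min (fun a => κ.p j (x a j) / κ.q j (x a j)) fun a =>
      (div_pos (κ.pos_p j _ (hx a j)) (κ.pos_q j _ (hx a j))).le)
  have hmono : ∀ a b, x a j ≤ x b j →
      κ.p j (x a j) / κ.q j (x a j) ≤ κ.p j (x b j) / κ.q j (x b j) := by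
    intro a b hab
    rcases hab.eq_or_lt with e | hlt
    · rw [e]
    · rw [div_le_div_iff₀ (κ.pos_q j _ (hx a j)) (κ.pos_q j _ (hx b j))]
      linarith [κ.det_pos j _ (Set.Ioo_subset_Icc_self (hx a j)) _
        (Set.Ioo_subset_Icc_self (hx b j)) hlt]
  convert! h using 1
  ext a b
  have ha := (κ.pos_q j _ (hx a j)).ne'
  have hb := (κ.pos_q j _ (hx b j)).ne'
  simp only [hadamard_apply, Matrix.of_apply]
  rcases le_total (x a j) (x b j) with hab | hab
  · rw [min_eq_left hab, max_eq_right hab, min_eq_left (hmono a b hab)]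
    field_simp
  · rw [min_eq_right hab, max_eq_left hab, min_eq_right (hmono b a hab)]
    field_simp

/-- The piecewise linear hat function with nodes `a < y < b`. -/
noncomputable def hat (a y b t : ℝ) : ℝ := max 0 (min ((t - a) / (y - a)) ((b - t) / (b - y)))

theorem hat_nonneg (a y b t : ℝ) : 0 ≤ hat a y b t := le_max_left _ _

section Hat

variable {a y b t : ℝ}

theorem hat_of_le_left (hay : a < y) (ht : t ≤ a) : hat a y b t = 0 :=
  max_eq_left ((min_le_left _ _).trans
    (div_nonpos_of_nonpos_of_nonneg (by linarith) (by linarith)))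

theorem hat_of_right_le (hyb : y < b) (ht : b ≤ t) : hat a y b t = 0 :=
  max_eq_left ((min_le_right _ _).trans
    (div_nonpos_of_nonpos_of_nonneg (by linarith) (by linarith)))

theorem hat_of_mem_left (hay : a < y) (hyb : y < b) (h1 : a ≤ t) (h2 : t ≤ y) :
    hat a y b t = (t - a) / (y - a) := by
  have e1 : (t - a) / (y - a) ≤ 1 := (div_le_one (by linarith)).2 (by linarith)
  have e2 : 1 ≤ (b - t) / (b - y) := (one_le_div (by linarith)).2 (by linarith)
  rw [hat, min_eq_left (e1.trans e2), max_eq_right]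
  exact div_nonneg (by linarith) (by linarith)

theorem hat_of_mem_right (hay : a < y) (hyb : y < b) (h1 : y ≤ t) (h2 : t ≤ b) :
    hat a y b t = (b - t) / (b - y) := by
  have e1 : 1 ≤ (t - a) / (y - a) := (one_le_div (by linarith)).2 (by linarith)
  have e2 : (b - t) / (b - y) ≤ 1 := (div_le_one (by linarith)).2 (by linarith)
  rw [hat, min_eq_right (e2.trans e1), max_eq_right]
  exact div_nonneg (by linarith) (by linarith)

theorem hat_self (hay : a < y) (hyb : y < b) : hat a y b y = 1 := by
  rw [hat_of_mem_left hay hyb hay.le le_rfl, div_self (by linarith)]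

theorem hat_le_one (hay : a < y) (hyb : y < b) : hat a y b t ≤ 1 := by
  refine max_le zero_le_one ?_
  rcases le_total t y with h | h
  · exact (min_le_left _ _).trans ((div_le_one (by linarith)).2 (by linarith))
  · exact (min_le_right _ _).trans ((div_le_one (by linarith)).2 (by linarith))

/-- The second difference of `f` at the nodes `a < y < b`: the deviation of `f y` from the
linear interpolant of `f` at `a` and `b`. -/
noncomputable def surplus (a y b : ℝ) (f : ℝ → ℝ) : ℝ :=
  f y - (b - y) / (b - a) * f a - (y - a) / (b - a) * f b

theorem surplus_eq_zero_of_affine (hab : a < b) {f : ℝ → ℝ} (m c : ℝ)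
    (ha : f a = m * a + c) (hy : f y = m * y + c) (hb : f b = m * b + c) :
    surplus a y b f = 0 := by
  have : b - a ≠ 0 := by linarith
  rw [surplus, ha, hy, hb]
  field_simp
  ring

theorem surplus_bridge (hay : a < y) (hyb : y < b) (t : ℝ) :
    surplus a y b (fun s => min s t - s * t) =
      (y - a) * (b - y) / (b - a) * hat a y b t := by
  have h1 : b - a ≠ 0 := by linarith
  have h2 : b - y ≠ 0 := by linarith
  have h3 : y - a ≠ 0 := by linarith
  rcases le_total t a with hta | hta
  · rw [hat_of_le_left hay hta, mul_zero]
    refine surplus_eq_zero_of_affine (by linarith) (-t) t ?_ ?_ ?_ <;>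
    · rw [min_eq_right (by linarith)]; ring
  rcases le_total b t with htb | htb
  · rw [hat_of_right_le hyb htb, mul_zero]
    refine surplus_eq_zero_of_affine (by linarith) (1 - t) 0 ?_ ?_ ?_ <;>
    · rw [min_eq_left (by linarith)]; ring
  rcases le_total t y with hty | hty
  · rw [hat_of_mem_left hay hyb hta hty]
    simp only [surplus]
    rw [min_eq_right hty, min_eq_left hta, min_eq_right htb]
    field_simp
    ring
  · rw [hat_of_mem_right hay hyb hty htb]
    simp only [surplus]
    rw [min_eq_left hty, min_eq_left hta, min_eq_right htb]
    field_simp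
    ring

/-- The surplus of a hat function vanishes as soon as none of the three nodes of the hat lies
strictly inside the surplus stencil. -/
theorem surplus_hat_of_nodes_outside {a' y' b' : ℝ} (hay : a < y) (hyb : y < b)
    (hay' : a' < y') (hyb' : y' < b') (h1 : a' ≤ a ∨ b ≤ a') (h2 : y' ≤ a ∨ b ≤ y')
    (h3 : b' ≤ a ∨ b ≤ b') : surplus a y b (hat a' y' b') = 0 := by
  have hab := hay.trans hyb
  rcases h1 with h1 | h1
  · rcases h2 with h2 | h2
    · rcases h3 with h3 | h3
      · refine surplus_eq_zero_of_affine hab 0 0 ?_ ?_ ?_ <;>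
        · rw [hat_of_right_le hyb' (by linarith)]; simp
      · refine surplus_eq_zero_of_affine hab (-1 / (b' - y')) (b' / (b' - y')) ?_ ?_ ?_ <;>
        · rw [hat_of_mem_right hay' hyb' (by linarith) (by linarith)]; ring
    · refine surplus_eq_zero_of_affine hab (1 / (y' - a')) (-a' / (y' - a')) ?_ ?_ ?_ <;>
      · rw [hat_of_mem_left hay' hyb' (by linarith) (by linarith)]; ring
  · refine surplus_eq_zero_of_affine hab 0 0 ?_ ?_ ?_ <;>
    · rw [hat_of_le_left hay' (by linarith)]; simp

theorem surplus_hat_of_stencil_outside {a' y' b' : ℝ}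
    (hay' : a' < y') (hyb' : y' < b') (h1 : a ≤ a' ∨ b' ≤ a) (h2 : y ≤ a' ∨ b' ≤ y)
    (h3 : b ≤ a' ∨ b' ≤ b) : surplus a y b (hat a' y' b') = 0 := by
  have key : ∀ s, s ≤ a' ∨ b' ≤ s → hat a' y' b' s = 0 := fun s hs =>
    hs.elim (hat_of_le_left hay') (hat_of_right_le hyb')
  simp [surplus, key _ h1, key _ h2, key _ h3]

theorem surplus_hat_self (hay : a < y) (hyb : y < b) : surplus a y b (hat a y b) = 1 := by
  simp [surplus, hat_self hay hyb, hat_of_le_left hay le_rfl, hat_of_right_le hyb le_rfl]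

end Hat

/-- A dyadic node of level `l` in its reduced form. -/
def IsNode (l i : ℕ) : Prop := Odd i ∧ i < 2 ^ l

theorem cpt_le_cpt_iff {l l' i i' : ℕ} : cpt l i ≤ cpt l' i' ↔ i * 2 ^ l' ≤ i' * 2 ^ l := by
  rw [cpt, cpt, div_le_div_iff₀ (by positivity) (by positivity)]
  exact_mod_cast Iff.rfl

theorem cpt_lt_cpt_iff {l l' i i' : ℕ} : cpt l i < cpt l' i' ↔ i * 2 ^ l' < i' * 2 ^ l := by
  rw [cpt, cpt, div_lt_div_iff₀ (by positivity) (by positivity)]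
  exact_mod_cast Iff.rfl

theorem cpt_zero (l : ℕ) : cpt l 0 = 0 := by simp [cpt]

theorem cpt_two_pow (l : ℕ) : cpt l (2 ^ l) = 1 := by simp [cpt]

theorem cpt_injective (l : ℕ) : Function.Injective (cpt l) := fun _ _ h =>
  Nat.eq_of_mul_eq_mul_right (by positivity)
    (le_antisymm (cpt_le_cpt_iff.1 h.le) (cpt_le_cpt_iff.1 h.ge))

theorem cpt_mem_Icc {l i : ℕ} (hi : i ≤ 2 ^ l) : cpt l i ∈ Set.Icc (0 : ℝ) 1 := by
  refine ⟨by unfold cpt; positivity, ?_⟩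
  rw [← cpt_two_pow l, cpt_le_cpt_iff]
  gcongr

theorem cpt_mem_Ioo {l i : ℕ} (hi : 0 < i) (hi' : i < 2 ^ l) : cpt l i ∈ Set.Ioo (0 : ℝ) 1 := by
  refine ⟨by unfold cpt; positivity, ?_⟩
  rw [← cpt_two_pow l, cpt_lt_cpt_iff]
  gcongr

theorem cpt_succ_mul_two (l i : ℕ) : cpt (l + 1) (2 * i) = cpt l i := by
  simp only [cpt]; push_cast; rw [pow_succ]; field_simp

/-- A node of level `l` separates no dyadic point of a coarser level from its neighbours. -/
theorem cpt_le_pred_or_succ_le {l l' i m : ℕ} (hi : Odd i) (hl : l' < l) :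
    cpt l' m ≤ cpt l (i - 1) ∨ cpt l (i + 1) ≤ cpt l' m := by
  obtain ⟨c, rfl⟩ : ∃ c, l = l' + 1 + c := ⟨l - l' - 1, by omega⟩
  obtain ⟨e, rfl⟩ := hi
  have key : ∀ u v : ℕ, cpt l' u ≤ cpt (l' + 1 + c) v ↔ u * (2 * 2 ^ c) ≤ v := by
    intro u v
    rw [cpt_le_cpt_iff, show u * 2 ^ (l' + 1 + c) = u * (2 * 2 ^ c) * 2 ^ l' by ring]
    exact Nat.mul_le_mul_right_iff (by positivity)
  have key' : ∀ u v : ℕ, cpt (l' + 1 + c) v ≤ cpt l' u ↔ v ≤ u * (2 * 2 ^ c) := by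
    intro u v
    rw [cpt_le_cpt_iff, show u * 2 ^ (l' + 1 + c) = u * (2 * 2 ^ c) * 2 ^ l' by ring]
    exact Nat.mul_le_mul_right_iff (by positivity)
  rw [key, key', show m * (2 * 2 ^ c) = 2 * (m * 2 ^ c) by ring]
  omega

/-- A one-dimensional Markov kernel in reduced form: the kernel is
`h s * h t * (min (g s) (g t) - g s * g t)`, a rescaled and time-changed Brownian bridge. -/
structure BridgeProfile where
  g : ℝ → ℝ
  h : ℝ → ℝ
  lower : ℝ
  upper : ℝ
  strictMono_g : StrictMonoOn g (Set.Icc 0 1)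
  g_zero : g 0 = 0
  g_one : g 1 = 1
  lower_pos : 0 < lower
  lower_le : ∀ x ∈ Set.Icc (0 : ℝ) 1, lower ≤ h x
  le_upper : ∀ x ∈ Set.Icc (0 : ℝ) 1, h x ≤ upper

namespace BridgeProfile

variable (P : BridgeProfile)

theorem h_pos {x : ℝ} (hx : x ∈ Set.Icc (0 : ℝ) 1) : 0 < P.h x :=
  P.lower_pos.trans_le (P.lower_le x hx)

theorem upper_pos : 0 < P.upper :=
  (P.h_pos (x := 0) (by simp)).trans_le (P.le_upper 0 (by simp))

/-- The kernel attached to a profile. -/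
noncomputable def ker (s t : ℝ) : ℝ := P.h s * P.h t * (min (P.g s) (P.g t) - P.g s * P.g t)

/-- The image under `g` of a dyadic point. -/
noncomputable def gpt (l i : ℕ) : ℝ := P.g (cpt l i)

/-- The hierarchical basis function of a node. -/
noncomputable def basis (l i : ℕ) (t : ℝ) : ℝ :=
  P.h t * hat (P.gpt l (i - 1)) (P.gpt l i) (P.gpt l (i + 1)) (P.g t)

/-- The coefficient with which the value at `t` enters the surplus functional of a node. -/
noncomputable def coeff (l i : ℕ) (t : ℝ) : ℝ :=
  if t = cpt l i then (P.h t)⁻¹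
  else if t = cpt l (i - 1) then
    -((P.gpt l (i + 1) - P.gpt l i) / (P.gpt l (i + 1) - P.gpt l (i - 1))) * (P.h t)⁻¹
  else if t = cpt l (i + 1) then
    -((P.gpt l i - P.gpt l (i - 1)) / (P.gpt l (i + 1) - P.gpt l (i - 1))) * (P.h t)⁻¹
  else 0

/-- The diagonal weight of a node. -/
noncomputable def weight (l i : ℕ) : ℝ :=
  (P.gpt l i - P.gpt l (i - 1)) * (P.gpt l (i + 1) - P.gpt l i) /
    (P.gpt l (i + 1) - P.gpt l (i - 1))

/-- The stencil of a node. -/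
noncomputable def stencil (l i : ℕ) : Finset ℝ := {cpt l i, cpt l (i - 1), cpt l (i + 1)}

theorem coeff_eq_zero {l i : ℕ} {t : ℝ} (ht : t ∉ stencil l i) : P.coeff l i t = 0 := by
  simp only [stencil, Finset.mem_insert, Finset.mem_singleton, not_or] at ht
  rw [coeff, if_neg ht.1, if_neg ht.2.1, if_neg ht.2.2]

variable {P} {l i : ℕ}

theorem gpt_lt (hi' : i < 2 ^ l) : P.gpt l i < P.gpt l (i + 1) := by
  refine P.strictMono_g (cpt_mem_Icc hi'.le) (cpt_mem_Icc hi') ?_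
  rw [cpt_lt_cpt_iff]
  gcongr
  omega

theorem gpt_pred_lt (hi : IsNode l i) : P.gpt l (i - 1) < P.gpt l i := by
  have h1 := hi.1.pos
  have h2 := hi.2
  obtain ⟨e, rfl⟩ : ∃ e, i = e + 1 := ⟨i - 1, by omega⟩
  exact gpt_lt (by omega)

theorem weight_pos (hi : IsNode l i) : 0 < P.weight l i := by
  have h1 := gpt_pred_lt (P := P) hi
  have h2 := gpt_lt (P := P) hi.2
  exact div_pos (mul_pos (by linarith) (by linarith)) (by linarith)

theorem basis_nonneg {t : ℝ} (ht : t ∈ Set.Icc (0 : ℝ) 1) : 0 ≤ P.basis l i t :=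
  mul_nonneg (P.h_pos ht).le (hat_nonneg _ _ _ _)

theorem basis_le (hi : IsNode l i) {t : ℝ} (ht : t ∈ Set.Icc (0 : ℝ) 1) :
    P.basis l i t ≤ P.upper :=
  (mul_le_of_le_one_right (P.h_pos ht).le
    (hat_le_one (gpt_pred_lt hi) (gpt_lt hi.2))).trans (P.le_upper t ht)

theorem node_mem_Icc (hi : IsNode l i) : cpt l (i - 1) ∈ Set.Icc (0 : ℝ) 1 ∧
    cpt l i ∈ Set.Icc (0 : ℝ) 1 ∧ cpt l (i + 1) ∈ Set.Icc (0 : ℝ) 1 := by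
  have := hi.2
  exact ⟨cpt_mem_Icc (by omega), cpt_mem_Icc (by omega), cpt_mem_Icc (by omega)⟩

theorem sum_stencil (hi : IsNode l i) (F : ℝ → ℝ) :
    ∑ t ∈ stencil l i, F t = F (cpt l i) + (F (cpt l (i - 1)) + F (cpt l (i + 1))) := by
  have := hi.1.pos
  have hne : ∀ u v : ℕ, u ≠ v → cpt l u ≠ cpt l v := fun _ _ => (cpt_injective l).ne
  rw [stencil, Finset.sum_insert, Finset.sum_pair]
  · exact hne _ _ (by omega)
  · simp only [Finset.mem_insert, Finset.mem_singleton, not_or]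
    exact ⟨hne _ _ (by omega), hne _ _ (by omega)⟩

theorem coeff_values (hi : IsNode l i) :
    P.coeff l i (cpt l i) = (P.h (cpt l i))⁻¹ ∧
    P.coeff l i (cpt l (i - 1)) =
      -((P.gpt l (i + 1) - P.gpt l i) / (P.gpt l (i + 1) - P.gpt l (i - 1))) *
        (P.h (cpt l (i - 1)))⁻¹ ∧
    P.coeff l i (cpt l (i + 1)) =
      -((P.gpt l i - P.gpt l (i - 1)) / (P.gpt l (i + 1) - P.gpt l (i - 1))) *
        (P.h (cpt l (i + 1)))⁻¹ := by
  have := hi.1.pos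
  have hne : ∀ u v : ℕ, u ≠ v → cpt l u ≠ cpt l v := fun _ _ => (cpt_injective l).ne
  have e1 := hne (i - 1) i (by omega)
  have e2 := hne (i + 1) i (by omega)
  have e3 := hne (i + 1) (i - 1) (by omega)
  simp [coeff, e1, e2, e3]

/-- Summing against the coefficients computes the surplus in the `g` coordinate. -/
theorem sum_coeff_mul (hi : IsNode l i) (F f : ℝ → ℝ)
    (hF : ∀ t ∈ Set.Icc (0 : ℝ) 1, F t = P.h t * f (P.g t)) :
    ∑ t ∈ stencil l i, P.coeff l i t * F t =
      surplus (P.gpt l (i - 1)) (P.gpt l i) (P.gpt l (i + 1)) f := by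
  obtain ⟨m1, m2, m3⟩ := node_mem_Icc hi
  obtain ⟨c1, c2, c3⟩ := coeff_values (P := P) hi
  rw [sum_stencil hi, c1, c2, c3, hF _ m1, hF _ m2, hF _ m3, surplus]
  have := (P.h_pos m1).ne'
  have := (P.h_pos m2).ne'
  have := (P.h_pos m3).ne'
  simp only [gpt]
  field_simp
  ring

theorem sum_coeff_mul_ker (hi : IsNode l i) (z : ℝ) :
    ∑ t ∈ stencil l i, P.coeff l i t * P.ker t z = P.weight l i * P.basis l i z := by
  rw [sum_coeff_mul hi _ (fun s => P.h z * (min s (P.g z) - s * P.g z))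
    (fun t _ => by rw [ker]; ring)]
  have h := surplus_bridge (gpt_pred_lt (P := P) hi) (gpt_lt (P := P) hi.2) (P.g z)
  rw [weight, basis, mul_left_comm, ← h, surplus, surplus]
  ring

theorem sum_coeff_mul_basis_self (hi : IsNode l i) :
    ∑ t ∈ stencil l i, P.coeff l i t * P.basis l i t = 1 := by
  rw [sum_coeff_mul hi (P.basis l i) (hat _ _ _) (fun t _ => rfl)]
  exact surplus_hat_self (gpt_pred_lt hi) (gpt_lt hi.2)

theorem sum_coeff_mul_basis_of_ne {l' i' : ℕ} (hi : IsNode l i) (hi' : IsNode l' i')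
    (hne : cpt l i ≠ cpt l' i') :
    ∑ t ∈ stencil l i, P.coeff l i t * P.basis l' i' t = 0 := by
  rw [sum_coeff_mul hi (P.basis l' i') (hat _ _ _) (fun t _ => rfl)]
  obtain ⟨m1, m2, m3⟩ := node_mem_Icc hi
  obtain ⟨m1', m2', m3'⟩ := node_mem_Icc hi'
  have mono : ∀ {s t : ℝ}, s ∈ Set.Icc (0 : ℝ) 1 → t ∈ Set.Icc (0 : ℝ) 1 → s ≤ t →
      P.g s ≤ P.g t := fun hs ht => (P.strictMono_g.le_iff_le hs ht).2
  rcases lt_trichotomy l l' with hl | rfl | hl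
  · refine surplus_hat_of_stencil_outside (gpt_pred_lt hi') (gpt_lt hi'.2) ?_ ?_ ?_
    · exact (cpt_le_pred_or_succ_le hi'.1 hl).imp (mono m1 m1') (mono m3' m1)
    · exact (cpt_le_pred_or_succ_le hi'.1 hl).imp (mono m2 m1') (mono m3' m2)
    · exact (cpt_le_pred_or_succ_le hi'.1 hl).imp (mono m3 m1') (mono m3' m3)
  · have hii : i ≠ i' := fun h => hne (by rw [h])
    obtain ⟨e, rfl⟩ := hi.1
    obtain ⟨e', rfl⟩ := hi'.1
    have mono' : ∀ {u v : ℕ}, cpt l u ∈ Set.Icc (0 : ℝ) 1 → cpt l v ∈ Set.Icc (0 : ℝ) 1 →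
        u ≤ v → P.gpt l u ≤ P.gpt l v := fun hu hv huv =>
      mono hu hv (cpt_le_cpt_iff.2 (by gcongr))
    rcases lt_or_gt_of_ne (show e ≠ e' by rintro rfl; exact hii rfl) with h | h
    · refine surplus_hat_of_stencil_outside (gpt_pred_lt hi') (gpt_lt hi'.2) ?_ ?_ ?_
      · exact Or.inl (mono' m1 m1' (by omega))
      · exact Or.inl (mono' m2 m1' (by omega))
      · exact Or.inl (mono' m3 m1' (by omega))
    · refine surplus_hat_of_stencil_outside (gpt_pred_lt hi') (gpt_lt hi'.2) ?_ ?_ ?_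
      · exact Or.inr (mono' m3' m1 (by omega))
      · exact Or.inr (mono' m3' m2 (by omega))
      · exact Or.inr (mono' m3' m3 (by omega))
  · refine surplus_hat_of_nodes_outside (gpt_pred_lt hi) (gpt_lt hi.2)
      (gpt_pred_lt hi') (gpt_lt hi'.2) ?_ ?_ ?_
    · exact (cpt_le_pred_or_succ_le hi.1 hl).imp (mono m1' m1) (mono m3 m1')
    · exact (cpt_le_pred_or_succ_le hi.1 hl).imp (mono m2' m1) (mono m3 m2')
    · exact (cpt_le_pred_or_succ_le hi.1 hl).imp (mono m3' m1) (mono m3 m3')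

theorem sum_abs_coeff_le (hi : IsNode l i) :
    ∑ t ∈ stencil l i, |P.coeff l i t| ≤ 2 / P.lower := by
  obtain ⟨m1, m2, m3⟩ := node_mem_Icc hi
  obtain ⟨c1, c2, c3⟩ := coeff_values (P := P) hi
  have hinv : ∀ t ∈ Set.Icc (0 : ℝ) 1, |(P.h t)⁻¹| ≤ P.lower⁻¹ := fun t ht => by
    rw [abs_of_pos (inv_pos.2 (P.h_pos ht))]
    exact inv_anti₀ P.lower_pos (P.lower_le t ht)
  have h1 := gpt_pred_lt (P := P) hi
  have h2 := gpt_lt (P := P) hi.2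
  rw [sum_stencil hi, c1, c2, c3, abs_mul, abs_mul, abs_neg, abs_neg,
    abs_of_pos (div_pos (sub_pos.2 h2) (by linarith)),
    abs_of_pos (div_pos (sub_pos.2 h1) (by linarith))]
  set w := (P.gpt l (i + 1) - P.gpt l i) / (P.gpt l (i + 1) - P.gpt l (i - 1)) with hw
  have hw' : (P.gpt l i - P.gpt l (i - 1)) / (P.gpt l (i + 1) - P.gpt l (i - 1)) = 1 - w := by
    have : P.gpt l (i + 1) - P.gpt l (i - 1) ≠ 0 := by linarith
    rw [hw]; field_simp; ring
  have hw0 : 0 ≤ w := div_nonneg (by linarith) (by linarith)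
  have hw1 : 0 ≤ 1 - w := hw' ▸ div_nonneg (by linarith) (by linarith)
  rw [hw']
  have e1 := mul_le_mul_of_nonneg_left (hinv _ m1) hw0
  have e3 := mul_le_mul_of_nonneg_left (hinv _ m3) hw1
  rw [div_eq_mul_inv]
  linarith [hinv _ m2]

/-- At a given level, at most one basis function is nonzero at a given point. -/
theorem basis_level_injective {i' : ℕ} (hi : IsNode l i) (hi' : IsNode l i') {t : ℝ}
    (h : P.basis l i t ≠ 0) (h' : P.basis l i' t ≠ 0) : i = i' := by
  by_contra hne
  wlog hlt : i < i' generalizing i i'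
  · exact this hi' hi h' h (Ne.symm hne) (by omega)
  obtain ⟨e, rfl⟩ := hi.1
  obtain ⟨e', rfl⟩ := hi'.1
  have h1 : P.g t < P.gpt l (2 * e + 1 + 1) := by
    by_contra! hc
    exact h (by rw [basis, hat_of_right_le (gpt_lt hi.2) hc, mul_zero])
  have h2 : P.gpt l (2 * e' + 1 - 1) < P.g t := by
    by_contra! hc
    exact h' (by rw [basis, hat_of_le_left (gpt_pred_lt hi') hc, mul_zero])
  have h3 : P.gpt l (2 * e + 1 + 1) ≤ P.gpt l (2 * e' + 1 - 1) :=
    (P.strictMono_g.le_iff_le (node_mem_Icc hi).2.2 (node_mem_Icc hi').1).2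
      (cpt_le_cpt_iff.2 (by gcongr; omega))
  linarith

theorem ker_zero (z : ℝ) (hz : z ∈ Set.Icc (0 : ℝ) 1) : P.ker 0 z = 0 := by
  have : P.g 0 ≤ P.g z := (P.strictMono_g.le_iff_le (by simp) hz).2 hz.1
  rw [P.g_zero] at this
  simp [ker, P.g_zero, this]

theorem ker_one (z : ℝ) (hz : z ∈ Set.Icc (0 : ℝ) 1) : P.ker 1 z = 0 := by
  have : P.g z ≤ P.g 1 := (P.strictMono_g.le_iff_le hz (by simp)).2 hz.2
  rw [P.g_one] at this
  simp [ker, P.g_one, this]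

theorem basis_zero (hi : IsNode l i) : P.basis l i 0 = 0 := by
  rw [basis, hat_of_le_left (gpt_pred_lt hi), mul_zero]
  exact (P.strictMono_g.le_iff_le (by simp) (node_mem_Icc hi).1).2 (node_mem_Icc hi).1.1

theorem basis_one (hi : IsNode l i) : P.basis l i 1 = 0 := by
  rw [basis, hat_of_right_le (gpt_lt hi.2), mul_zero]
  exact (P.strictMono_g.le_iff_le (node_mem_Icc hi).2.2 (by simp)).2 (node_mem_Icc hi).2.2.2

end BridgeProfile

section Tensor

open BridgeProfile

variable {d n : ℕ} (P : Fin d → BridgeProfile) (L I : Fin n → Fin d → ℕ)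
  (x : Fin n → Fin d → ℝ)

/-- The tensor product hierarchical basis function of the design point `a`. -/
noncomputable def tensorBasis (a : Fin n) (z : Fin d → ℝ) : ℝ :=
  ∏ j, (P j).basis (L a j) (I a j) (z j)

/-- The matrix of hierarchical surplus functionals of a design. -/
noncomputable def surplusMat : Matrix (Fin n) (Fin n) ℝ :=
  Matrix.of fun a b => ∏ j, (P j).coeff (L a j) (I a j) (x b j)

/-- The matrix of values of the hierarchical basis functions at the design points. -/
noncomputable def basisMat : Matrix (Fin n) (Fin n) ℝ :=
  Matrix.of fun b a => tensorBasis P L I a (x b)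

/-- The tensor product kernel attached to profiles. -/
noncomputable def tensorKer (s t : Fin d → ℝ) : ℝ := ∏ j, (P j).ker (s j) (t j)

/-- A design whose points are represented by dyadic nodes and which contains all interior points
of the stencils of its points. -/
structure IsStencilClosed : Prop where
  injective : Function.Injective x
  isNode : ∀ a j, IsNode (L a j) (I a j)
  eq_cpt : ∀ a j, x a j = cpt (L a j) (I a j)
  mem_range : ∀ a (t : Fin d → ℝ), (∀ j, t j ∈ stencil (L a j) (I a j)) →
    (∀ j, t j ∈ Set.Ioo (0 : ℝ) 1) → t ∈ Set.range x

variable {P L I x}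

theorem stencil_subset_Icc {l i : ℕ} (hi : IsNode l i) {t : ℝ} (ht : t ∈ stencil l i) :
    t ∈ Set.Icc (0 : ℝ) 1 := by
  obtain ⟨m1, m2, m3⟩ := node_mem_Icc hi
  simp only [stencil, Finset.mem_insert, Finset.mem_singleton] at ht
  rcases ht with rfl | rfl | rfl <;> assumption

theorem IsStencilClosed.sum_surplusMat_mul (hx : IsStencilClosed L I x) (a : Fin n)
    (F : Fin d → ℝ → ℝ) (h0 : ∀ j, F j 0 = 0) (h1 : ∀ j, F j 1 = 0) :
    ∑ b, surplusMat P L I x a b * ∏ j, F j (x b j) =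
      ∏ j, ∑ t ∈ stencil (L a j) (I a j), (P j).coeff (L a j) (I a j) t * F j t := by
  classical
  rw [Finset.prod_univ_sum]
  simp only [surplusMat, Matrix.of_apply, ← Finset.prod_mul_distrib]
  rw [← Finset.sum_image (s := Finset.univ) (g := x)
    (f := fun t => ∏ j, (P j).coeff (L a j) (I a j) (t j) * F j (t j)) hx.injective.injOn]
  refine Finset.sum_congr_of_eq_on_inter ?_ ?_ (fun _ _ _ => rfl)
  · intro t _ ht
    simp only [Fintype.mem_piFinset, not_forall] at ht
    obtain ⟨j, hj⟩ := ht
    exact Finset.prod_eq_zero (Finset.mem_univ j) (by rw [coeff_eq_zero _ hj, zero_mul])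
  · intro t ht ht'
    rw [Fintype.mem_piFinset] at ht
    have : ∃ j, t j ∉ Set.Ioo (0 : ℝ) 1 := by
      by_contra! hc
      obtain ⟨b, rfl⟩ := hx.mem_range a t ht hc
      exact ht' (Finset.mem_image_of_mem _ (Finset.mem_univ b))
    obtain ⟨j, hj⟩ := this
    have hI := stencil_subset_Icc (hx.isNode a j) (ht j)
    have : t j = 0 ∨ t j = 1 := by
      by_contra! hc
      exact hj ⟨lt_of_le_of_ne hI.1 (Ne.symm hc.1), lt_of_le_of_ne hI.2 hc.2⟩
    refine Finset.prod_eq_zero (Finset.mem_univ j) ?_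
    rcases this with e | e <;> simp [e, h0, h1]

theorem IsStencilClosed.surplusMat_mulVec_tensorKer (hx : IsStencilClosed L I x)
    {z : Fin d → ℝ} (hz : ∀ j, z j ∈ Set.Icc (0 : ℝ) 1) (a : Fin n) :
    ∑ b, surplusMat P L I x a b * tensorKer P (x b) z =
      (∏ j, (P j).weight (L a j) (I a j)) * tensorBasis P L I a z := by
  have h := hx.sum_surplusMat_mul (P := P) a (fun j t => (P j).ker t (z j))
    (fun j => ker_zero _ (hz j)) (fun j => ker_one _ (hz j))
  simp only [tensorKer, tensorBasis]
  rw [h, ← Finset.prod_mul_distrib]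
  exact Finset.prod_congr rfl fun j _ => sum_coeff_mul_ker (hx.isNode a j) _

theorem IsStencilClosed.surplusMat_mul_basisMat (hx : IsStencilClosed L I x) :
    surplusMat P L I x * basisMat P L I x = 1 := by
  ext a c
  rw [Matrix.mul_apply]
  simp only [basisMat, Matrix.of_apply, tensorBasis]
  rw [hx.sum_surplusMat_mul (P := P) a (fun j t => (P j).basis (L c j) (I c j) t)
    (fun j => basis_zero (hx.isNode c j)) (fun j => basis_one (hx.isNode c j))]
  by_cases hac : a = c
  · subst hac
    rw [Matrix.one_apply_eq]
    exact Finset.prod_eq_one fun j _ => sum_coeff_mul_basis_self (hx.isNode a j)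
  · rw [Matrix.one_apply_ne hac]
    have : ∃ j, x a j ≠ x c j := by
      by_contra! hc
      exact hac (hx.injective (funext hc))
    obtain ⟨j, hj⟩ := this
    rw [hx.eq_cpt, hx.eq_cpt] at hj
    exact Finset.prod_eq_zero (Finset.mem_univ j)
      (sum_coeff_mul_basis_of_ne (hx.isNode a j) (hx.isNode c j) hj)

theorem IsStencilClosed.mem_Icc (hx : IsStencilClosed L I x) (a : Fin n) (j : Fin d) :
    x a j ∈ Set.Icc (0 : ℝ) 1 := by
  rw [hx.eq_cpt]
  exact (node_mem_Icc (hx.isNode a j)).2.1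

/-- The kernel matrix of a stencil-closed design is factored by the hierarchical basis. -/
theorem IsStencilClosed.kernel_factorization (hx : IsStencilClosed L I x) :
    (Matrix.of fun a b => tensorKer P (x a) (x b)) =
      basisMat P L I x * (Matrix.diagonal fun a => ∏ j, (P j).weight (L a j) (I a j)) *
        (basisMat P L I x)ᵀ := by
  have hS := hx.surplusMat_mul_basisMat (P := P)
  have hS' := mul_eq_one_comm.1 hS
  have hSK : surplusMat P L I x * (Matrix.of fun a b => tensorKer P (x a) (x b)) =
      (Matrix.diagonal fun a => ∏ j, (P j).weight (L a j) (I a j)) * (basisMat P L I x)ᵀ := by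
    ext a c
    rw [Matrix.diagonal_mul, Matrix.mul_apply]
    exact hx.surplusMat_mulVec_tensorKer (hx.mem_Icc c) a
  rw [Matrix.mul_assoc, ← hSK, ← Matrix.mul_assoc, hS', Matrix.one_mul]

theorem IsStencilClosed.isUnit_kernel (hx : IsStencilClosed L I x) :
    IsUnit (Matrix.of fun a b => tensorKer P (x a) (x b)) := by
  have hS' := mul_eq_one_comm.1 (hx.surplusMat_mul_basisMat (P := P))
  have hB : IsUnit (basisMat P L I x).det :=
    (Matrix.isUnit_iff_isUnit_det _).1 (IsUnit.of_mul_eq_one _ hS')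
  rw [Matrix.isUnit_iff_isUnit_det, hx.kernel_factorization, Matrix.det_mul, Matrix.det_mul,
    Matrix.det_transpose, Matrix.det_diagonal]
  refine (hB.mul (IsUnit.mk0 _ ?_)).mul hB
  exact Finset.prod_ne_zero_iff.2 fun a _ => Finset.prod_ne_zero_iff.2 fun j _ =>
    (weight_pos (hx.isNode a j)).ne'

/-- The kriging weights at `z` are obtained from the surplus functionals and the values of the
hierarchical basis functions at `z`. -/
theorem IsStencilClosed.kernel_mulVec_weights (hx : IsStencilClosed L I x)
    {z : Fin d → ℝ} (hz : ∀ j, z j ∈ Set.Icc (0 : ℝ) 1) :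
    (Matrix.of fun a b => tensorKer P (x a) (x b)) *ᵥ
        ((surplusMat P L I x)ᵀ *ᵥ fun a => tensorBasis P L I a z) =
      fun a => tensorKer P (x a) z := by
  have hS := hx.surplusMat_mul_basisMat (P := P)
  have hS' := mul_eq_one_comm.1 hS
  have hk : surplusMat P L I x *ᵥ (fun a => tensorKer P (x a) z) =
      (Matrix.diagonal fun a => ∏ j, (P j).weight (L a j) (I a j)) *ᵥ
        fun a => tensorBasis P L I a z := by
    ext a
    rw [Matrix.mulVec_diagonal]
    exact hx.surplusMat_mulVec_tensorKer hz a
  rw [hx.kernel_factorization, mulVec_mulVec, Matrix.mul_assoc, ← Matrix.transpose_mul, hS,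
    Matrix.transpose_one, Matrix.mul_one, ← mulVec_mulVec, ← hk, mulVec_mulVec, hS', one_mulVec]

theorem IsStencilClosed.sum_abs_surplusMat_le (hx : IsStencilClosed L I x) (a : Fin n) :
    ∑ b, |surplusMat P L I x a b| ≤ ∏ j, 2 / (P j).lower := by
  classical
  calc ∑ b, |surplusMat P L I x a b|
      = ∑ t ∈ Finset.univ.image x, ∏ j, |(P j).coeff (L a j) (I a j) (t j)| := by
        rw [Finset.sum_image hx.injective.injOn]
        simp [surplusMat, Finset.abs_prod]
    _ ≤ ∑ t ∈ Fintype.piFinset fun j => stencil (L a j) (I a j),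
          ∏ j, |(P j).coeff (L a j) (I a j) (t j)| := by
        rw [← Finset.sum_filter_ne_zero (s := Finset.univ.image x)]
        refine Finset.sum_le_sum_of_subset_of_nonneg (fun t ht => ?_)
          fun t _ _ => Finset.prod_nonneg fun j _ => abs_nonneg _
        rw [Fintype.mem_piFinset]
        intro j
        by_contra hj
        exact (Finset.mem_filter.1 ht).2 (Finset.prod_eq_zero (Finset.mem_univ j) (by rw [coeff_eq_zero _ hj, abs_zero]))
    _ = ∏ j, ∑ t ∈ stencil (L a j) (I a j), |(P j).coeff (L a j) (I a j) t| :=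
        by rw [Finset.prod_univ_sum]
    _ ≤ ∏ j, 2 / (P j).lower :=
        Finset.prod_le_prod (fun j _ => Finset.sum_nonneg fun t _ => abs_nonneg _)
          fun j _ => sum_abs_coeff_le (hx.isNode a j)

theorem IsStencilClosed.sum_abs_tensorBasis_le (hx : IsStencilClosed L I x) {T : ℕ}
    (hT : ∀ a j, L a j ≤ T) {z : Fin d → ℝ} (hz : ∀ j, z j ∈ Set.Icc (0 : ℝ) 1) :
    ∑ a, |tensorBasis P L I a z| ≤ (T : ℝ) ^ d * ∏ j, (P j).upper := by
  classical
  have hle : ∀ a, |tensorBasis P L I a z| ≤ ∏ j, (P j).upper := fun a => by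
    rw [tensorBasis, abs_of_nonneg (Finset.prod_nonneg fun j _ => basis_nonneg (hz j))]
    exact Finset.prod_le_prod (fun j _ => basis_nonneg (hz j))
      fun j _ => basis_le (hx.isNode a j) (hz j)
  have hU : 0 ≤ ∏ j, (P j).upper := Finset.prod_nonneg fun j _ => (P j).upper_pos.le
  set A := Finset.univ.filter fun a => tensorBasis P L I a z ≠ 0 with hA
  have hcard : A.card ≤ T ^ d := by
    have h : A.card ≤ (Fintype.piFinset fun _ : Fin d => Finset.Icc 1 T).card := by
      refine Finset.card_le_card_of_injOn L (fun a _ => ?_) fun a ha b hb hab => ?_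
      · simp only [Finset.mem_coe, Fintype.mem_piFinset, Finset.mem_Icc]
        refine fun j => ⟨?_, hT a j⟩
        have h1 := (hx.isNode a j).1.pos
        have h2 := (hx.isNode a j).2
        by_contra! h0
        have : L a j = 0 := by omega
        rw [this] at h2
        omega
      · simp only [hA, Finset.coe_filter, Finset.mem_univ, true_and, Set.mem_ofPred_eq] at ha hb
        refine hx.injective (funext fun j => ?_)
        have h1 := Finset.prod_ne_zero_iff.1 ha j (Finset.mem_univ j)
        have h2 := Finset.prod_ne_zero_iff.1 hb j (Finset.mem_univ j)
        have n2 := hx.isNode b j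
        rw [hx.eq_cpt, hx.eq_cpt, hab]
        rw [← hab] at h2 n2
        rw [basis_level_injective (hx.isNode a j) n2 h1 h2]
    simpa using h
  calc ∑ a, |tensorBasis P L I a z| = ∑ a ∈ A, |tensorBasis P L I a z| := by
        refine (Finset.sum_subset (Finset.subset_univ _) fun a _ ha => ?_).symm
        have : tensorBasis P L I a z = 0 := by simpa [hA] using ha
        rw [this, abs_zero]
    _ ≤ A.card • ∏ j, (P j).upper := Finset.sum_le_card_nsmul _ _ _ fun a _ => hle a
    _ ≤ (T : ℝ) ^ d * ∏ j, (P j).upper := by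
        rw [nsmul_eq_mul]
        gcongr
        exact_mod_cast hcard

theorem IsStencilClosed.sum_abs_weights_le (hx : IsStencilClosed L I x) {T : ℕ}
    (hT : ∀ a j, L a j ≤ T) {z : Fin d → ℝ} (hz : ∀ j, z j ∈ Set.Icc (0 : ℝ) 1) :
    ∑ b, |((surplusMat P L I x)ᵀ *ᵥ fun a => tensorBasis P L I a z) b| ≤
      (T : ℝ) ^ d * (∏ j, (P j).upper) * ∏ j, 2 / (P j).lower := by
  have hl : 0 ≤ ∏ j, 2 / (P j).lower :=
    Finset.prod_nonneg fun j _ => (div_pos two_pos (P j).lower_pos).le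
  calc ∑ b, |((surplusMat P L I x)ᵀ *ᵥ fun a => tensorBasis P L I a z) b|
      ≤ ∑ b, ∑ a, |surplusMat P L I x a b| * |tensorBasis P L I a z| := by
        refine Finset.sum_le_sum fun b _ => ?_
        simp only [mulVec, dotProduct, Matrix.transpose_apply]
        refine (Finset.abs_sum_le_sum_abs _ _).trans (le_of_eq ?_)
        simp only [abs_mul]
    _ = ∑ a, (∑ b, |surplusMat P L I x a b|) * |tensorBasis P L I a z| := by
        rw [Finset.sum_comm]
        simp only [Finset.sum_mul]
    _ ≤ ∑ a, (∏ j, 2 / (P j).lower) * |tensorBasis P L I a z| :=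
        Finset.sum_le_sum fun a _ => mul_le_mul_of_nonneg_right
          (hx.sum_abs_surplusMat_le a) (abs_nonneg _)
    _ = (∑ a, |tensorBasis P L I a z|) * ∏ j, 2 / (P j).lower := by
        rw [← Finset.mul_sum, mul_comm]
    _ ≤ _ := mul_le_mul_of_nonneg_right (hx.sum_abs_tensorBasis_le hT hz) hl

end Tensor

section SparseGrid

open BridgeProfile

theorem exists_isNode_of_cpt {l i : ℕ} (hi : 1 ≤ i) (hi' : i < 2 ^ l) :
    ∃ l' i', l' ≤ l ∧ 1 ≤ l' ∧ IsNode l' i' ∧ cpt l i = cpt l' i' := by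
  induction l generalizing i with
  | zero => simp at hi'; omega
  | succ l ih =>
    rcases Nat.even_or_odd' i with ⟨m, rfl | hm⟩
    · obtain ⟨l', i', h1, h2, h3, h4⟩ := ih (i := m) (by omega) (by rw [pow_succ] at hi'; omega)
      exact ⟨l', i', by omega, h2, h3, (cpt_succ_mul_two l m).trans h4⟩
    · exact ⟨l + 1, i, le_rfl, by omega, ⟨⟨m, hm⟩, hi'⟩, rfl⟩

/-- An interior stencil neighbour of a node belongs to the next coarser level. -/
theorem stencil_neighbour {l i : ℕ} (hi : IsNode l i) {t : ℝ} (ht : t ∈ stencil l i)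
    (ht' : t ∈ Set.Ioo (0 : ℝ) 1) (hne : t ≠ cpt l i) :
    ∃ l' m, l = l' + 1 ∧ 1 ≤ l' ∧ 1 ≤ m ∧ m ≤ 2 ^ l' - 1 ∧ t = cpt l' m := by
  obtain ⟨⟨e, rfl⟩, hlt⟩ := hi
  obtain ⟨l', rfl⟩ : ∃ l', l = l' + 1 := by
    cases l with
    | zero => simp at hlt
    | succ l' => exact ⟨l', rfl⟩
  obtain ⟨m, hm⟩ : ∃ m, t = cpt l' m := by
    simp only [stencil, Finset.mem_insert, Finset.mem_singleton] at ht
    rcases ht with h | h | h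
    · exact absurd h hne
    · exact ⟨e, by rw [h, ← cpt_succ_mul_two l' e]; rfl⟩
    · exact ⟨e + 1, by rw [h, ← cpt_succ_mul_two l' (e + 1)]; rfl⟩
  rw [hm, ← cpt_zero l', ← cpt_two_pow l', Set.mem_Ioo, cpt_lt_cpt_iff, cpt_lt_cpt_iff] at ht'
  have h1 : 0 < m := by
    by_contra! h0
    simp [Nat.le_zero.1 h0] at ht'
  have h2 : m < 2 ^ l' := lt_of_mul_lt_mul_right ht'.2 (Nat.zero_le _)
  refine ⟨l', m, rfl, ?_, h1, by omega, hm⟩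
  by_contra! h0
  have : l' = 0 := by omega
  subst this
  omega

theorem exists_isStencilClosed {d n τ : ℕ} (hd : 1 ≤ d) {x : Fin n → Fin d → ℝ}
    (hinj : Function.Injective x) (hlow : SGset d τ ⊆ Set.range x)
    (hup : Set.range x ⊆ SGset d (τ + 1)) :
    ∃ L I : Fin n → Fin d → ℕ, IsStencilClosed L I x ∧ ∀ a j, L a j ≤ τ + 1 := by
  have hnode : ∀ a, ∃ L I : Fin d → ℕ, (∀ j, 1 ≤ L j) ∧ ∑ j, L j ≤ τ + d ∧
      ∀ j, IsNode (L j) (I j) ∧ x a j = cpt (L j) (I j) := by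
    intro a
    obtain ⟨l, hl1, hls, hl⟩ := hup ⟨a, rfl⟩
    have : ∀ j, ∃ l' i', l' ≤ l j ∧ 1 ≤ l' ∧ IsNode l' i' ∧ x a j = cpt l' i' := by
      intro j
      obtain ⟨i, h1, h2, h3⟩ := hl j
      rw [h3]
      exact exists_isNode_of_cpt h1 (by omega)
    choose L I h1 h2 h3 h4 using this
    refine ⟨L, I, h2, ?_, fun j => ⟨h3 j, h4 j⟩⟩
    have := Finset.sum_le_sum fun j (_ : j ∈ Finset.univ) => h1 j
    omega
  choose L I hL hsum hLI using hnode
  refine ⟨L, I, ⟨hinj, fun a j => (hLI a j).1, fun a j => (hLI a j).2, ?_⟩, ?_⟩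
  · intro a t ht ht'
    by_cases hta : t = x a
    · exact ⟨a, hta.symm⟩
    obtain ⟨j₀, hj₀⟩ := Function.ne_iff.1 hta
    apply hlow
    have : ∀ j, ∃ l', 1 ≤ l' ∧ l' ≤ L a j ∧ (t j ≠ x a j → l' < L a j) ∧
        ∃ i, 1 ≤ i ∧ i ≤ 2 ^ l' - 1 ∧ t j = cpt l' i := by
      intro j
      by_cases hj : t j = x a j
      · have h1 := (hLI a j).1.1.pos
        have h2 := (hLI a j).1.2
        exact ⟨L a j, hL a j, le_rfl, fun h => absurd hj h, I a j, by omega, by omega,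
          hj.trans (hLI a j).2⟩
      · obtain ⟨l', m, h1, h2, h3, h4, h5⟩ := stencil_neighbour (hLI a j).1 (ht j) (ht' j)
          (fun h => hj (h.trans (hLI a j).2.symm))
        exact ⟨l', h2, by omega, fun _ => by omega, m, h3, h4, h5⟩
    choose l' h1 h2 h3 h4 using this
    have hlt : ∑ j, l' j < ∑ j, L a j :=
      Finset.sum_lt_sum (fun j _ => h2 j) ⟨j₀, Finset.mem_univ _, h3 j₀ hj₀⟩
    have := hsum a
    exact ⟨l', h1, by omega, h4⟩
  · intro a j
    have h1 : ∑ i ∈ Finset.univ.erase j, 1 ≤ ∑ i ∈ Finset.univ.erase j, L a i :=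
      Finset.sum_le_sum fun i _ => hL a i
    have h2 := Finset.add_sum_erase Finset.univ (L a) (Finset.mem_univ j)
    have h3 := hsum a
    rw [Finset.sum_const, Finset.card_erase_of_mem (Finset.mem_univ j), Finset.card_univ,
      Fintype.card_fin, smul_eq_mul, mul_one] at h1
    omega

theorem two_pow_le_of_SGset_subset {d n τ : ℕ} (hd : 1 ≤ d) (hτ : 1 ≤ τ)
    {x : Fin n → Fin d → ℝ} (hlow : SGset d τ ⊆ Set.range x) : 2 ^ τ ≤ n + 1 := by
  let j₀ : Fin d := ⟨0, hd⟩
  let f : Fin (2 ^ τ - 1) → Fin d → ℝ := fun i =>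
    Function.update (fun _ => cpt 1 1) j₀ (cpt τ (i + 1))
  have hf : ∀ i, f i ∈ SGset d τ := by
    intro i
    have hi := i.2
    refine ⟨Function.update (fun _ => 1) j₀ τ, fun j => ?_, ?_, fun j => ?_⟩
    · by_cases h : j = j₀
      · subst h; simpa using hτ
      · simp [h]
    · rw [Finset.sum_update_of_mem (Finset.mem_univ _)]
      simp only [Finset.sum_const, smul_eq_mul, mul_one, Finset.card_sdiff, Finset.card_univ,
        Fintype.card_fin, Finset.inter_univ, Finset.card_singleton]
      omega
    · by_cases h : j = j₀
      · subst h
        exact ⟨i + 1, by omega, by simp only [Function.update_self]; omega, by simp [f]⟩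
      · exact ⟨1, le_rfl, by simp [h], by simp [f, h]⟩
  choose a ha using fun i => hlow (hf i)
  have hinj : Function.Injective a := by
    intro i i' h
    have h1 : f i = f i' := by rw [← ha, ← ha, h]
    have h2 : cpt τ (i + 1) = cpt τ (i' + 1) := by simpa [f] using congrFun h1 j₀
    have := cpt_injective τ h2
    exact Fin.ext (by omega)
  have := Fintype.card_le_of_injective a hinj
  simp only [Fintype.card_fin] at this
  omega

theorem level_le_log {n τ : ℕ} (hn : 2 ≤ n) (hτ : 1 ≤ τ) (h : 2 ^ τ ≤ n + 1) :
    ((τ + 1 : ℕ) : ℝ) ≤ 4 / Real.log 2 * Real.log n := by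
  have hlog2 : 0 < Real.log 2 := Real.log_pos one_lt_two
  have h1 : (2 : ℝ) ^ τ ≤ (n : ℝ) ^ 2 := by
    have : 2 ^ τ ≤ n ^ 2 := h.trans (by nlinarith)
    exact_mod_cast this
  have h2 := Real.log_le_log (by positivity) h1
  rw [Real.log_pow, Real.log_pow] at h2
  have h3 : (1 : ℝ) ≤ τ := by exact_mod_cast hτ
  rw [div_mul_eq_mul_div, le_div_iff₀ hlog2]
  push_cast at h2 ⊢
  nlinarith

end SparseGrid

/-- Each factor of a tensor Markov kernel agrees on the open unit interval with the kernel of a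
bridge profile. -/
theorem TMKernelSL.exists_bridgeProfile {d : ℕ} (κ : TMKernelSL d) (j : Fin d) :
    ∃ P : BridgeProfile, ∀ s ∈ Set.Ioo (0 : ℝ) 1, ∀ t ∈ Set.Ioo (0 : ℝ) 1,
      P.ker s t = κ.p j (min s t) * κ.q j (max s t) := by
  classical
  have hp0 : ∀ x ∈ Set.Icc (0 : ℝ) 1, 0 ≤ κ.p j x := fun x hx => by
    have : Set.Icc (0 : ℝ) 1 = closure (Set.Ioo 0 1) := (closure_Ioo zero_ne_one).symm
    refine ContinuousWithinAt.closure_le (f := fun _ => (0 : ℝ)) (g := κ.p j) (this ▸ hx)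
      continuousWithinAt_const ((κ.cont_p j x hx).mono Set.Ioo_subset_Icc_self)
      fun y hy => (κ.pos_p j y hy).le
  have hq0 : ∀ x ∈ Set.Icc (0 : ℝ) 1, 0 ≤ κ.q j x := fun x hx => by
    have : Set.Icc (0 : ℝ) 1 = closure (Set.Ioo 0 1) := (closure_Ioo zero_ne_one).symm
    refine ContinuousWithinAt.closure_le (f := fun _ => (0 : ℝ)) (g := κ.q j) (this ▸ hx)
      continuousWithinAt_const ((κ.cont_q j x hx).mono Set.Ioo_subset_Icc_self)
      fun y hy => (κ.pos_q j y hy).le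
  have hd := κ.det_pos j 0 (by simp) 1 (by simp) one_pos
  have hp00 := hp0 0 (by simp)
  have hp01 := hp0 1 (by simp)
  have hq00 := hq0 0 (by simp)
  have hq01 := hq0 1 (by simp)
  have hsum : ∀ x ∈ Set.Icc (0 : ℝ) 1, 0 < κ.p j x + κ.q j x := by
    intro x hx
    rcases hx.1.eq_or_lt with rfl | h0
    · by_contra! hc
      have : κ.q j 0 = 0 := by linarith
      rw [this] at hd
      nlinarith
    rcases hx.2.eq_or_lt with rfl | h1
    · by_contra! hc
      have : κ.p j 1 = 0 := by linarith
      rw [this] at hd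
      nlinarith
    exact add_pos (κ.pos_p j x ⟨h0, h1⟩) (κ.pos_q j x ⟨h0, h1⟩)
  have hcont : ContinuousOn (fun x => κ.p j x + κ.q j x) (Set.Icc 0 1) :=
    (κ.cont_p j).add (κ.cont_q j)
  obtain ⟨u, hu, hmin⟩ := isCompact_Icc.exists_isMinOn (Set.nonempty_Icc.2 zero_le_one) hcont
  obtain ⟨w, hw, hmax⟩ := isCompact_Icc.exists_isMaxOn (Set.nonempty_Icc.2 zero_le_one) hcont
  rw [isMinOn_iff] at hmin
  rw [isMaxOn_iff] at hmax
  let h : ℝ → ℝ := fun x => if x ∈ Set.Ioo (0 : ℝ) 1 then κ.p j x + κ.q j x else 1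
  let g : ℝ → ℝ := fun x => if x ≤ 0 then 0 else if 1 ≤ x then 1 else
    κ.p j x / (κ.p j x + κ.q j x)
  have hg : ∀ x ∈ Set.Ioo (0 : ℝ) 1, g x = κ.p j x / (κ.p j x + κ.q j x) := fun x hx => by
    simp only [g, if_neg hx.1.not_ge, if_neg hx.2.not_ge]
  have hh : ∀ x ∈ Set.Ioo (0 : ℝ) 1, h x = κ.p j x + κ.q j x := fun x hx => if_pos hx
  have hmono : StrictMonoOn g (Set.Icc 0 1) := by
    intro s hs t ht hst
    have ht0 : 0 < t := hs.1.trans_lt hst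
    have hs1 : s < 1 := hst.trans_le ht.2
    rcases hs.1.eq_or_lt with rfl | hs0
    · have e : g 0 = 0 := by simp [g]
      rw [e]
      rcases ht.2.eq_or_lt with rfl | ht1
      · simp [g, zero_lt_one.not_ge]
      · rw [hg t ⟨ht0, ht1⟩]
        exact div_pos (κ.pos_p j t ⟨ht0, ht1⟩) (hsum t ht)
    · rw [hg s ⟨hs0, hs1⟩]
      rcases ht.2.eq_or_lt with rfl | ht1
      · have e : g 1 = 1 := by simp [g]
        rw [e, div_lt_one (hsum s hs)]
        linarith [κ.pos_q j s ⟨hs0, hs1⟩]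
      · rw [hg t ⟨ht0, ht1⟩, div_lt_div_iff₀ (hsum s hs) (hsum t ht)]
        linarith [κ.det_pos j s hs t ht hst]
  refine ⟨{
    g := g
    h := h
    lower := min 1 (κ.p j u + κ.q j u)
    upper := max 1 (κ.p j w + κ.q j w)
    strictMono_g := hmono
    g_zero := by simp [g]
    g_one := by simp [g]
    lower_pos := lt_min one_pos (hsum u hu)
    lower_le := fun x hx => ?_
    le_upper := fun x hx => ?_ }, ?_⟩
  · by_cases hx' : x ∈ Set.Ioo (0 : ℝ) 1
    · rw [hh x hx']; exact (min_le_right _ _).trans (hmin x hx)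
    · simp only [h, if_neg hx']; exact min_le_left _ _
  · by_cases hx' : x ∈ Set.Ioo (0 : ℝ) 1
    · rw [hh x hx']; exact (hmax x hx).trans (le_max_right _ _)
    · simp only [h, if_neg hx']; exact le_max_left _ _
  · have key : ∀ s ∈ Set.Ioo (0 : ℝ) 1, ∀ t ∈ Set.Ioo (0 : ℝ) 1,
        h s * h t * (g s - g s * g t) = κ.p j s * κ.q j t := by
      intro s hs t ht
      have h1 := (hsum s (Set.Ioo_subset_Icc_self hs)).ne'
      have h2 := (hsum t (Set.Ioo_subset_Icc_self ht)).ne'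
      rw [hh s hs, hh t ht, hg s hs, hg t ht]
      field_simp
      ring
    intro s hs t ht
    simp only [BridgeProfile.ker]
    rcases le_total s t with hst | hst
    · rw [min_eq_left hst, max_eq_right hst, min_eq_left ((hmono.le_iff_le
        (Set.Ioo_subset_Icc_self hs) (Set.Ioo_subset_Icc_self ht)).2 hst), key s hs t ht]
    · rw [min_eq_right hst, max_eq_left hst, min_eq_right ((hmono.le_iff_le
        (Set.Ioo_subset_Icc_self ht) (Set.Ioo_subset_Icc_self hs)).2 hst), ← key t ht s hs]
      ring

theorem TMKernelSL.exists_diagonal_bound {d : ℕ} (κ : TMKernelSL d) :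
    ∃ V : ℝ, 0 < V ∧ ∀ z : Fin d → ℝ, (∀ j, z j ∈ Set.Ioo (0 : ℝ) 1) → κ.k z z ≤ V := by
  have hb : ∀ j, ∃ B : ℝ, 0 < B ∧ ∀ t ∈ Set.Icc (0 : ℝ) 1, κ.p j t * κ.q j t ≤ B := by
    intro j
    obtain ⟨B, hB⟩ := isCompact_Icc.bddAbove_image ((κ.cont_p j).mul (κ.cont_q j))
    exact ⟨max B 1, by positivity, fun t ht =>
      (hB (Set.mem_image_of_mem _ ht)).trans (le_max_left _ _)⟩
  choose B hB0 hB using hb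
  refine ⟨∏ j, B j, Finset.prod_pos fun j _ => hB0 j, fun z hz => ?_⟩
  simp only [TMKernelSL.k, min_self, max_self]
  exact Finset.prod_le_prod
    (fun j _ => (mul_pos (κ.pos_p j _ (hz j)) (κ.pos_q j _ (hz j))).le)
    fun j _ => hB j _ (Set.Ioo_subset_Icc_self (hz j))

/-- **Lemma EC.6 (regularization gap), Ding & Zhang.** For a TM kernel satisfying
Assumption SL and a TSG design of size `n`, for every `λ > 0` and `z ∈ (0,1)^d`,
`0 ≤ k(z)ᵀK⁻¹k(z) − k(z)ᵀ(K+λI)⁻¹k(z) ≤ C √λ (log n)^d`, with `C` depending only on `k`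
and `d`. -/
theorem regularized_kriging_gap (d : ℕ) (hd : 1 ≤ d) (κ : TMKernelSL d) :
    ∃ C : ℝ, 0 < C ∧ ∀ n : ℕ, 2 ≤ n → ∀ x : Fin n → Fin d → ℝ, IsTSGDesign x →
      ∀ lam : ℝ, 0 < lam →
      ∀ z : Fin d → ℝ, (∀ j, z j ∈ Set.Ioo (0:ℝ) 1) →
        0 ≤ kerVec κ x z ⬝ᵥ ((kerMat κ x)⁻¹ *ᵥ kerVec κ x z)
            - kerVec κ x z ⬝ᵥ
                ((kerMat κ x + lam • (1 : Matrix (Fin n) (Fin n) ℝ))⁻¹ *ᵥ kerVec κ x z) ∧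
        kerVec κ x z ⬝ᵥ ((kerMat κ x)⁻¹ *ᵥ kerVec κ x z)
            - kerVec κ x z ⬝ᵥ
                ((kerMat κ x + lam • (1 : Matrix (Fin n) (Fin n) ℝ))⁻¹ *ᵥ kerVec κ x z)
          ≤ C * Real.sqrt lam * Real.log n ^ d := by
  choose P hP using κ.exists_bridgeProfile
  obtain ⟨V, hV0, hV⟩ := κ.exists_diagonal_bound
  have hlog2 : 0 < Real.log 2 := Real.log_pos one_lt_two
  have hU : 0 < ∏ j, (P j).upper := Finset.prod_pos fun j _ => (P j).upper_pos
  have hl : 0 < ∏ j, 2 / (P j).lower :=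
    Finset.prod_pos fun j _ => div_pos two_pos (P j).lower_pos
  refine ⟨√V * ((4 / Real.log 2) ^ d * (∏ j, (P j).upper) * ∏ j, 2 / (P j).lower),
    by positivity, ?_⟩
  rintro n hn x ⟨hinj, τ, hτ, -, -, hlow, hup⟩ lam hlam z hz
  obtain ⟨L, I, hx, hT⟩ := exists_isStencilClosed hd hinj hlow hup
  have hz' : ∀ j, z j ∈ Set.Icc (0 : ℝ) 1 := fun j => Set.Ioo_subset_Icc_self (hz j)
  have hx01 : ∀ a j, x a j ∈ Set.Ioo (0 : ℝ) 1 := fun a j => by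
    rw [hx.eq_cpt]
    exact cpt_mem_Ioo (hx.isNode a j).1.pos (hx.isNode a j).2
  have hker : ∀ s t : Fin d → ℝ, (∀ j, s j ∈ Set.Ioo (0 : ℝ) 1) →
      (∀ j, t j ∈ Set.Ioo (0 : ℝ) 1) → tensorKer P s t = κ.k s t := fun s t hs ht =>
    Finset.prod_congr rfl fun j _ => hP j _ (hs j) _ (ht j)
  have hsymm : ∀ s t : Fin d → ℝ, κ.k s t = κ.k t s := fun s t =>
    Finset.prod_congr rfl fun j _ => by rw [min_comm, max_comm]
  have hK : (Matrix.of fun a b => tensorKer P (x a) (x b)) = kerMat κ x := by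
    ext a b
    exact hker _ _ (hx01 a) (hx01 b)
  have hk : (fun a => tensorKer P (x a) z) = kerVec κ x z := by
    ext a
    exact (hker _ _ (hx01 a) hz).trans (hsymm _ _)
  have hw := hx.kernel_mulVec_weights (P := P) hz'
  have hunit := hx.isUnit_kernel (P := P)
  rw [hK, hk] at hw
  rw [hK] at hunit
  have hVz : kerVec κ x z ⬝ᵥ ((surplusMat P L I x)ᵀ *ᵥ fun a => tensorBasis P L I a z) ≤ V := by
    let E := {s : Fin d → ℝ // ∀ j, s j ∈ Set.Ioo (0 : ℝ) 1}
    have h := dotProduct_le_of_gram_posSemidef (E := E) (fun s t => κ.k s.1 t.1)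
      (fun s => κ.posSemidef_gram (fun o => (s o).1) fun o => (s o).2) ⟨z, hz⟩
      (fun a => ⟨x a, hx01 a⟩) hw
    exact h.trans (hV z hz)
  obtain ⟨h0, h1⟩ := dotProduct_inv_sub_regularized_bounds (κ.posSemidef_gram x hx01) hunit hw
    hlam hVz (hx.sum_abs_weights_le hT hz')
  refine ⟨h0, h1.trans ?_⟩
  have hlev := level_le_log hn hτ (two_pow_le_of_SGset_subset hd hτ hlow)
  calc √V * √lam * (((τ + 1 : ℕ) : ℝ) ^ d * (∏ j, (P j).upper) * ∏ j, 2 / (P j).lower)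
      ≤ √V * √lam * ((4 / Real.log 2 * Real.log n) ^ d * (∏ j, (P j).upper) *
          ∏ j, 2 / (P j).lower) := by gcongr
    _ = _ := by rw [mul_pow]; ring
end
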